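/- For every ε > 0 there exists k₀ = k₀(ε) such that for all integers k ≥ k₀ and every real r with 0 < r ≤ 2^{k-1} ln 2 − (ln 2)/2 − (1+ε)/2, the probability that the random hypergraph H_k(n, ⌈rn⌉) is 2-colorable tends to 1 as n → ∞. -/

import Mathlib

open Filter Real

/-- A multi-hypergraph given as a tuple of `m` edges, each a `k`-element subset of
`{1,…,n}` (modeled as `Fin n`), is 2-colorable if there is a 2-coloring of the
vertices under which no edge is monochromatic. -/
def IsTwoColorable {n k m : ℕ} (E : Fin m → {s : Finset (Fin n) // s.card = k}) : Prop :=
  ∃ c : Fin n → Bool, ∀ i : Fin m, ∃ u ∈ (E i).1, ∃ v ∈ (E i).1, c u ≠ c v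

/-- The probability that the random `k`-uniform hypergraph `H_k(n,m)`, whose `m` edges
are chosen uniformly, independently and with replacement from all `C(n,k)` possible
`k`-subsets of the vertex set, is 2-colorable. -/
noncomputable def probTwoColorable (k n m : ℕ) : ℝ :=
  (Nat.card {E : Fin m → {s : Finset (Fin n) // s.card = k} // IsTwoColorable E} : ℝ) /
    ((n.choose k : ℝ) ^ m)

open scoped BigOperators
set_option linter.unusedSectionVars false

namespace HG

section Abstract
variable {T Ω : Type*} [Fintype T] [Nonempty T] [Fintype Ω] [Nonempty Ω]

lemma expect_pi_prod (m : ℕ) (f : T → ℝ) :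
    𝔼 e : Fin m → T, ∏ i, f (e i) = (𝔼 t, f t) ^ m := by
  classical
  rw [Fintype.expect_eq_sum_div_card, Fintype.expect_eq_sum_div_card, div_pow, Fintype.sum_pow]
  simp

lemma expect_fin_succ (m : ℕ) (F : (Fin (m + 1) → T) → ℝ) :
    𝔼 e : Fin (m + 1) → T, F e = 𝔼 e : Fin m → T, 𝔼 t : T, F (Fin.cons t e) := by
  classical
  have h : 𝔼 e : Fin (m + 1) → T, F e = 𝔼 p : T × (Fin m → T), F (Fin.cons p.1 p.2) := by
    symm
    exact Fintype.expect_equiv (Fin.consEquiv (fun _ => T)) _ _ (fun p => rfl)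
  rw [h, ← Finset.univ_product_univ, Finset.expect_product, Finset.expect_comm]

/-- normalised partition function -/
noncomputable def PF (w : T → Ω → ℝ) {m : ℕ} (e : Fin m → T) : ℝ := 𝔼 σ, ∏ i, w (e i) σ

lemma expect_PF_mul (x w : T → Ω → ℝ) (m : ℕ) :
    𝔼 e : Fin m → T, PF x e * PF w e = 𝔼 σ, 𝔼 τ, (𝔼 t, x t σ * w t τ) ^ m := by
  have h : ∀ e : Fin m → T, PF x e * PF w e = 𝔼 σ, 𝔼 τ, ∏ i, (x (e i) σ * w (e i) τ) := by
    intro e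
    simp only [PF, Finset.expect_mul_expect, Finset.prod_mul_distrib]
  simp only [h]
  rw [Finset.expect_comm]
  refine Finset.expect_congr rfl fun σ _ => ?_
  rw [Finset.expect_comm]
  refine Finset.expect_congr rfl fun τ _ => ?_
  exact expect_pi_prod m (fun t => x t σ * w t τ)

lemma expect_PF (w : T → Ω → ℝ) (m : ℕ) (h : ∀ σ, 𝔼 t, w t σ = 1) :
    𝔼 e : Fin m → T, PF w e = 1 := by
  simp only [PF]
  rw [Finset.expect_comm]
  have : ∀ σ, 𝔼 e : Fin m → T, ∏ i, w (e i) σ = 1 := fun σ => by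
    rw [expect_pi_prod m (fun t => w t σ), h, one_pow]
  simp only [this]
  simp

lemma log_one_add_ge {z : ℝ} (hz : |z| ≤ 1 / 2) : z - 2 * z ^ 2 ≤ Real.log (1 + z) := by
  have h := abs_le.1 hz
  have h1 : 0 < 1 + z := by linarith
  have h2 := Real.one_sub_inv_le_log_of_pos h1
  have : z - 2 * z ^ 2 ≤ 1 - (1 + z)⁻¹ := by
    rw [show 1 - (1 + z)⁻¹ = z / (1 + z) by field_simp; ring, le_div_iff₀ h1]
    nlinarith [mul_nonneg (sq_nonneg z) (by linarith : 0 ≤ z + 1/2)]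
  linarith

/-- One step of the Gronwall argument for a fixed positive weight `g`. -/
lemma step_bound (g : Ω → ℝ) (hg : ∀ σ, 0 < g σ) (η : T → Ω → ℝ) (hη : ∀ t σ, |η t σ| ≤ 1 / 2)
    (h0 : ∀ σ, 𝔼 t, η t σ = 0) (Q : Ω → Ω → ℝ) (b s : ℝ) (hb : 0 ≤ b) (hs : 0 < s)
    (h2 : ∀ σ τ, 𝔼 t, η t σ * η t τ = b * Q σ τ) :
    Real.log (𝔼 σ, g σ) - (2 * b / s) *
        ((𝔼 σ, 𝔼 τ, g σ * g τ * Real.exp (s * Q σ τ)) - 2 * Real.log (𝔼 σ, g σ))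
      ≤ 𝔼 t, Real.log (𝔼 σ, g σ * (1 + η t σ)) := by
  set Y := 𝔼 σ, g σ with hY
  have hYpos : 0 < Y := Finset.expect_pos (fun σ _ => hg σ) Finset.univ_nonempty
  set z : T → ℝ := fun t => (𝔼 σ, g σ * η t σ) / Y with hz
  have hzb : ∀ t, |z t| ≤ 1 / 2 := by
    intro t
    rw [hz]; simp only
    rw [abs_div, abs_of_pos hYpos, div_le_iff₀ hYpos]
    calc |𝔼 σ, g σ * η t σ| ≤ 𝔼 σ, |g σ * η t σ| := Finset.abs_expect_le _ _
      _ ≤ 𝔼 σ, 1 / 2 * g σ := by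
          refine Finset.expect_le_expect fun σ _ => ?_
          rw [abs_mul, abs_of_pos (hg σ)]
          nlinarith [hη t σ, hg σ]
      _ = 1 / 2 * Y := by rw [hY, Finset.mul_expect]
  have hlog : ∀ t, Real.log (𝔼 σ, g σ * (1 + η t σ)) = Real.log Y + Real.log (1 + z t) := by
    intro t
    have h1 : 0 < 1 + z t := by have := (abs_le.1 (hzb t)).1; linarith
    rw [← Real.log_mul hYpos.ne' h1.ne']
    congr 1
    simp only [mul_add, mul_one, Finset.expect_add_distrib, hz]
    field_simp
    rw [hY]
  have hz0 : 𝔼 t, z t = 0 := by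
    simp only [hz]
    rw [← Finset.expect_div, Finset.expect_comm]
    simp only [← Finset.mul_expect, h0]
    simp
  have hz2 : 𝔼 t, z t ^ 2 = b * (𝔼 σ, 𝔼 τ, g σ * g τ * Q σ τ) / Y ^ 2 := by
    have e1 : ∀ t, z t ^ 2 = (𝔼 σ, 𝔼 τ, (g σ * g τ) * (η t σ * η t τ)) / Y ^ 2 := by
      intro t
      simp only [hz, div_pow]
      congr 1
      rw [sq, Finset.expect_mul_expect]
      refine Finset.expect_congr rfl fun σ _ => Finset.expect_congr rfl fun τ _ => by ring
    simp only [e1]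
    rw [← Finset.expect_div]
    congr 1
    rw [Finset.expect_comm, Finset.mul_expect]
    refine Finset.expect_congr rfl fun σ _ => ?_
    rw [Finset.expect_comm, Finset.mul_expect]
    refine Finset.expect_congr rfl fun τ _ => ?_
    rw [← Finset.mul_expect, h2]; ring
  have hJ : s * (𝔼 σ, 𝔼 τ, g σ * g τ * Q σ τ) / Y ^ 2 ≤
      (𝔼 σ, 𝔼 τ, g σ * g τ * Real.exp (s * Q σ τ)) - 2 * Real.log Y := by
    have hY2 : (𝔼 σ, 𝔼 τ, g σ * g τ) = Y ^ 2 := by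
      rw [sq, hY, Finset.expect_mul_expect]
    have pt : ∀ σ τ, g σ * g τ * (s * Q σ τ) ≤
        g σ * g τ * Real.exp (s * Q σ τ) * Y ^ 2 - g σ * g τ * (2 * Real.log Y) := by
      intro σ τ
      have h3 := Real.add_one_le_exp (s * Q σ τ + 2 * Real.log Y)
      rw [Real.exp_add, show Real.exp (2 * Real.log Y) = Y ^ 2 by
        rw [two_mul, Real.exp_add, Real.exp_log hYpos, sq]] at h3
      have h4 : 0 < g σ * g τ := mul_pos (hg σ) (hg τ)
      nlinarith [mul_le_mul_of_nonneg_left h3 h4.le]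
    have h5 : (𝔼 σ, 𝔼 τ, g σ * g τ * (s * Q σ τ)) ≤ 𝔼 σ, 𝔼 τ,
        (g σ * g τ * Real.exp (s * Q σ τ) * Y ^ 2 - g σ * g τ * (2 * Real.log Y)) :=
      Finset.expect_le_expect fun σ _ => Finset.expect_le_expect fun τ _ => pt σ τ
    simp only [Finset.expect_sub_distrib, ← Finset.expect_mul] at h5
    rw [hY2] at h5
    have h6 : (𝔼 σ, 𝔼 τ, g σ * g τ * (s * Q σ τ)) = s * 𝔼 σ, 𝔼 τ, g σ * g τ * Q σ τ := by
      simp only [Finset.mul_expect]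
      refine Finset.expect_congr rfl fun σ _ => Finset.expect_congr rfl fun τ _ => by ring
    rw [h6] at h5
    rw [div_le_iff₀ (by positivity)]
    linarith
  have hfin : Real.log Y - 2 * 𝔼 t, z t ^ 2 ≤ 𝔼 t, Real.log (𝔼 σ, g σ * (1 + η t σ)) := by
    have : 𝔼 t, (Real.log Y + (z t - 2 * z t ^ 2)) ≤ 𝔼 t, Real.log (𝔼 σ, g σ * (1 + η t σ)) := by
      refine Finset.expect_le_expect fun t _ => ?_
      rw [hlog]
      have := log_one_add_ge (hzb t)
      linarith
    rw [Finset.expect_add_distrib, Finset.expect_sub_distrib, hz0, ← Finset.mul_expect,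
      Finset.expect_const Finset.univ_nonempty] at this
    linarith
  refine le_trans ?_ hfin
  rw [hz2]
  have : 2 * b / s * (s * (𝔼 σ, 𝔼 τ, g σ * g τ * Q σ τ) / Y ^ 2) ≤ 2 * b / s *
    ((𝔼 σ, 𝔼 τ, g σ * g τ * Real.exp (s * Q σ τ)) - 2 * Real.log Y) :=
    mul_le_mul_of_nonneg_left hJ (by positivity)
  have e : 2 * b / s * (s * (𝔼 σ, 𝔼 τ, g σ * g τ * Q σ τ) / Y ^ 2) =
    2 * (b * (𝔼 σ, 𝔼 τ, g σ * g τ * Q σ τ) / Y ^ 2) := by field_simp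
  linarith

/-- Lower bound on the expected log-partition function of the soft model. -/
lemma log_bound (η : T → Ω → ℝ) (hη : ∀ t σ, |η t σ| ≤ 1 / 2)
    (h0 : ∀ σ, 𝔼 t, η t σ = 0) (Q : Ω → Ω → ℝ) (hQ : ∀ σ τ, 0 ≤ Q σ τ) (b s K : ℝ)
    (hb : 0 ≤ b) (hs : 0 < s)
    (h2 : ∀ σ τ, 𝔼 t, η t σ * η t τ = b * Q σ τ) (M : ℕ)
    (hK : 𝔼 σ, 𝔼 τ, (1 + b * Q σ τ) ^ M * Real.exp (s * Q σ τ) ≤ K) (m : ℕ) (hm : m ≤ M) :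
    K - 2 * (𝔼 e : Fin m → T, Real.log (PF (fun t σ => 1 + η t σ) e)) ≤
      K * (1 + 4 * b / s) ^ m := by
  have hw : ∀ t σ, 0 < 1 + η t σ := fun t σ => by have := (abs_le.1 (hη t σ)).1; linarith
  have hww : ∀ σ τ, 𝔼 t, (1 + η t σ) * (1 + η t τ) = 1 + b * Q σ τ := by
    intro σ τ
    have : ∀ t, (1 + η t σ) * (1 + η t τ) = 1 + η t σ + η t τ + η t σ * η t τ := fun t => by ring
    simp only [this, Finset.expect_add_distrib, h0, h2]
    simp
  induction m with
  | zero => simp [PF]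
  | succ m ih =>
    have ih := ih (by omega)
    set w : T → Ω → ℝ := fun t σ => 1 + η t σ with hwdef
    rw [expect_fin_succ]
    have hstep : ∀ e : Fin m → T,
        Real.log (PF w e) - (2 * b / s) * ((𝔼 σ, 𝔼 τ, (∏ i, w (e i) σ) * (∏ i, w (e i) τ) *
          Real.exp (s * Q σ τ)) - 2 * Real.log (PF w e)) ≤ 𝔼 t, Real.log (PF w (Fin.cons t e : Fin (m+1) → T)) := by
      intro e
      have := step_bound (fun σ => ∏ i, w (e i) σ) (fun σ => Finset.prod_pos fun i _ => hw _ _) η hη h0 Q b s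
        hb hs h2
      refine this.trans (le_of_eq ?_)
      refine Finset.expect_congr rfl fun t _ => ?_
      congr 1
      simp only [PF, Fin.prod_univ_succ, Fin.cons_zero, Fin.cons_succ]
      refine Finset.expect_congr rfl fun σ _ => by rw [mul_comm]
    have hsum := Finset.expect_le_expect (s := Finset.univ) fun e (_ : e ∈ Finset.univ) => hstep e
    rw [Finset.expect_sub_distrib, ← Finset.mul_expect, Finset.expect_sub_distrib,
      ← Finset.mul_expect] at hsum
    have hW : 𝔼 e : Fin m → T, 𝔼 σ, 𝔼 τ, (∏ i, w (e i) σ) * (∏ i, w (e i) τ) *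
          Real.exp (s * Q σ τ) ≤ K := by
      refine le_trans ?_ hK
      rw [Finset.expect_comm]
      refine Finset.expect_le_expect fun σ _ => ?_
      rw [Finset.expect_comm]
      refine Finset.expect_le_expect fun τ _ => ?_
      rw [← Finset.expect_mul]
      refine mul_le_mul_of_nonneg_right ?_ (Real.exp_pos _).le
      simp only [← Finset.prod_mul_distrib]
      rw [expect_pi_prod m (fun t => w t σ * w t τ), hww]
      exact pow_le_pow_right₀ (by have := mul_nonneg hb (hQ σ τ); linarith) (by omega)
    set A := 𝔼 e : Fin m → T, Real.log (PF w e)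
    set A' := 𝔼 e : Fin m → T, 𝔼 t, Real.log (PF w (Fin.cons t e : Fin (m+1) → T))
    set W := 𝔼 e : Fin m → T, 𝔼 σ, 𝔼 τ, (∏ i, w (e i) σ) * (∏ i, w (e i) τ) * Real.exp (s * Q σ τ)
    have hbs : 0 ≤ 2 * b / s := by positivity
    have h7 : 2 * b / s * (W - 2 * A) ≤ 2 * b / s * (K - 2 * A) :=
      mul_le_mul_of_nonneg_left (by linarith) hbs
    have h8 : K - 2 * A' ≤ (K - 2 * A) * (1 + 4 * b / s) := by
      have : 4 * b / s = 2 * (2 * b / s) := by ring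
      rw [this]; nlinarith
    calc K - 2 * A' ≤ (K - 2 * A) * (1 + 4 * b / s) := h8
      _ ≤ K * (1 + 4 * b / s) ^ m * (1 + 4 * b / s) :=
          mul_le_mul_of_nonneg_right ih (by positivity)
      _ = _ := by ring

/-- Combined bound for the probability that the hard partition function vanishes. -/
lemma prob_zero_bound (x η : T → Ω → ℝ) (hη : ∀ t σ, |η t σ| ≤ 1 / 2)
    (h0 : ∀ σ, 𝔼 t, η t σ = 0) (Q q : Ω → Ω → ℝ) (hQ : ∀ σ τ, 0 ≤ Q σ τ) (b s K : ℝ)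
    (hb : 0 ≤ b) (hs : 0 < s)
    (h2 : ∀ σ τ, 𝔼 t, η t σ * η t τ = b * Q σ τ)
    (hxx : ∀ σ τ, 𝔼 t, x t σ * x t τ = 1 + q σ τ)
    (hxw : ∀ σ τ, 𝔼 t, x t σ * (1 + η t τ) = 1 + b * Q σ τ) (m : ℕ)
    (hK : 𝔼 σ, 𝔼 τ, (1 + b * Q σ τ) ^ m * Real.exp (s * Q σ τ) ≤ K) 
    (D : ℝ) (hD : 𝔼 σ, 𝔼 τ, ((1 + q σ τ) ^ m - (1 + b * Q σ τ) ^ m) ≤ D)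
    (θ : ℝ) (hθ : 0 < θ) (hθ1 : θ < 1) :
    𝔼 e : Fin m → T, (if PF x e = 0 then (1 : ℝ) else 0) ≤
      D / θ ^ 2 + (1 + K * (1 + 4 * b / s) ^ m / 2) / Real.log (1 / θ) := by
  set w : T → Ω → ℝ := fun t σ => 1 + η t σ with hwdef
  have hw : ∀ t σ, 0 < w t σ := fun t σ => by
    have := (abs_le.1 (hη t σ)).1; simp only [hwdef]; linarith
  have hww : ∀ σ τ, 𝔼 t, w t σ * w t τ = 1 + b * Q σ τ := by
    intro σ τ
    have : ∀ t, w t σ * w t τ = 1 + η t σ + η t τ + η t σ * η t τ := fun t => by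
      simp only [hwdef]; ring
    simp only [this, Finset.expect_add_distrib, h0, h2]
    simp
  have hw1 : ∀ σ, 𝔼 t, w t σ = 1 := by
    intro σ; simp only [hwdef, Finset.expect_add_distrib, h0]; simp
  have hYpos : ∀ e : Fin m → T, 0 < PF w e := fun e =>
    Finset.expect_pos (fun σ _ => Finset.prod_pos fun i _ => hw _ _) Finset.univ_nonempty
  have hlt : 0 < Real.log (1 / θ) := Real.log_pos (by rw [lt_div_iff₀ hθ]; linarith)
  have hA := log_bound η hη h0 Q hQ b s K hb hs h2 m hK m le_rfl
  have hK0 : 0 ≤ K := le_trans (Finset.expect_nonneg fun σ _ => Finset.expect_nonneg fun τ _ => by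
    have := mul_nonneg hb (hQ σ τ); positivity) hK
  have hXY : 𝔼 e : Fin m → T, (PF x e - PF w e) ^ 2 ≤ D := by
    refine le_trans (le_of_eq ?_) hD
    have : ∀ e : Fin m → T, (PF x e - PF w e) ^ 2 =
      PF x e * PF x e - 2 * (PF x e * PF w e) + PF w e * PF w e := fun e => by ring
    simp only [this]
    rw [Finset.expect_add_distrib, Finset.expect_sub_distrib, ← Finset.mul_expect, expect_PF_mul,
      expect_PF_mul, expect_PF_mul]
    simp only [hxx, hww, Finset.expect_sub_distrib]
    simp only [hwdef, hxw]
    ring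
  have pt : ∀ e : Fin m → T, (if PF x e = 0 then (1 : ℝ) else 0) ≤
      (PF x e - PF w e) ^ 2 / θ ^ 2 + (PF w e - Real.log (PF w e)) / Real.log (1 / θ) := by
    intro e
    have hl : 0 ≤ PF w e - Real.log (PF w e) := by
      have := Real.log_le_sub_one_of_pos (hYpos e); linarith
    have t2 : 0 ≤ (PF w e - Real.log (PF w e)) / Real.log (1 / θ) := div_nonneg hl hlt.le
    have t1 : 0 ≤ (PF x e - PF w e) ^ 2 / θ ^ 2 := by positivity
    split_ifs with h
    · rcases le_or_gt θ (PF w e) with h' | h'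
      · have : 1 ≤ (PF x e - PF w e) ^ 2 / θ ^ 2 := by
          rw [le_div_iff₀ (by positivity), h]
          nlinarith
        linarith
      · have : 1 ≤ (PF w e - Real.log (PF w e)) / Real.log (1 / θ) := by
          rw [le_div_iff₀ hlt]
          have := Real.log_le_log (hYpos e) h'.le
          rw [one_div, Real.log_inv]
          have := hYpos e
          linarith
        linarith
    · linarith
  refine (Finset.expect_le_expect fun e _ => pt e).trans ?_
  rw [Finset.expect_add_distrib, ← Finset.expect_div, ← Finset.expect_div,
    Finset.expect_sub_distrib, expect_PF w m hw1]
  refine add_le_add (div_le_div_of_nonneg_right hXY (by positivity))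
    (div_le_div_of_nonneg_right ?_ hlt.le)
  linarith

end Abstract
end HG

namespace HG

section Concrete

/-- balanced colourings of 4 * L vertices -/
abbrev Om (L : ℕ) := {S : Finset (Fin (4 * L)) // S.card = 2 * L}

instance (L : ℕ) : Nonempty (Om L) := by
  obtain ⟨S, -, hS⟩ := Finset.exists_subset_card_eq
    (show 2 * L ≤ (Finset.univ : Finset (Fin (4 * L))).card by simp; omega)
  exact ⟨⟨S, hS⟩⟩

lemma card_Om (L : ℕ) : Fintype.card (Om L) = (4 * L).choose (2 * L) := by
  have := Fintype.card_finset_len (α := Fin (4 * L)) (2 * L)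
  simpa using this

noncomputable def sg {L : ℕ} (S : Om L) (v : Fin (4 * L)) : ℝ := if v ∈ S.1 then 1 else -1

noncomputable def ov {L : ℕ} (S S' : Om L) : ℝ := 𝔼 v, sg S v * sg S' v

lemma sg_eq {L : ℕ} (S : Om L) (v : Fin (4 * L)) : sg S v = 2 * (if v ∈ S.1 then 1 else 0) - 1 := by
  unfold sg; split_ifs <;> norm_num

lemma expect_sg {L : ℕ} (S : Om L) : 𝔼 v, sg S v = 0 := by
  rw [Fintype.expect_eq_sum_div_card]
  simp only [sg_eq, Finset.sum_sub_distrib, ← Finset.mul_sum]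
  have : (S.1.card : ℝ) = 2 * L := by exact_mod_cast S.2
  simp [this]
  left; ring

lemma ov_eq {L : ℕ} (hL : 0 < L) (S S' : Om L) :
    ov S S' = (((S.1 ∩ S'.1).card : ℝ) - L) / L := by
  unfold ov
  rw [Fintype.expect_eq_sum_div_card]
  have h : ∀ v, sg S v * sg S' v = 4 * (if v ∈ S.1 ∩ S'.1 then 1 else 0) -
      2 * (if v ∈ S.1 then 1 else 0) - 2 * (if v ∈ S'.1 then 1 else 0) + 1 := by
    intro v
    by_cases h1 : v ∈ S.1 <;> by_cases h2 : v ∈ S'.1 <;> simp [sg, h1, h2] <;> norm_num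
  have e1 : (S.1.card : ℝ) = 2 * L := by exact_mod_cast S.2
  have e2 : (S'.1.card : ℝ) = 2 * L := by exact_mod_cast S'.2
  have hL' : (0 : ℝ) < L := by exact_mod_cast hL
  simp only [h, Finset.sum_add_distrib, Finset.sum_sub_distrib, ← Finset.mul_sum]
  have e3 : ∀ A : Finset (Fin (4 * L)), ∑ v, (if v ∈ A then (1:ℝ) else 0) = A.card := by
    intro A; simp
  rw [e3, e3, e3, e1, e2]
  simp
  field_simp
  ring

lemma expect_pi_prod' {k : ℕ} {V : Type*} [Fintype V] (f : Fin k → V → ℝ) :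
    𝔼 t : Fin k → V, ∏ i, f i (t i) = ∏ i, 𝔼 v, f i v := by
  classical
  simp only [Fintype.expect_eq_sum_div_card]
  rw [Finset.prod_div_distrib, Finset.prod_univ_sum]
  simp

noncomputable def chi {k L : ℕ} (A : Finset (Fin k)) (t : Fin k → Fin (4 * L)) (S : Om L) : ℝ :=
  ∏ i ∈ A, sg S (t i)

lemma expect_chi {k L : ℕ} (hL : 0 < L) (A B : Finset (Fin k)) (S S' : Om L) :
    𝔼 t : Fin k → Fin (4 * L), chi A t S * chi B t S' =
      if A = B then ov S S' ^ A.card else 0 := by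
  haveI : Nonempty (Fin (4 * L)) := ⟨⟨0, by omega⟩⟩
  have h : ∀ t : Fin k → Fin (4 * L), chi A t S * chi B t S' =
      ∏ i, ((if i ∈ A then sg S (t i) else 1) * (if i ∈ B then sg S' (t i) else 1)) := by
    intro t
    rw [Finset.prod_mul_distrib, Finset.prod_ite_mem, Finset.prod_ite_mem]
    simp [chi]
  simp only [h]
  rw [expect_pi_prod' (fun i v => (if i ∈ A then sg S v else 1) * (if i ∈ B then sg S' v else 1))]
  split_ifs with hAB
  · subst hAB
    have : ∀ i, 𝔼 v, ((if i ∈ A then sg S v else 1) * (if i ∈ A then sg S' v else 1)) =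
        if i ∈ A then ov S S' else 1 := by
      intro i
      split_ifs
      · rfl
      · simp
    simp only [this]
    rw [Finset.prod_ite_mem]; simp
  · have : ∃ i, ¬ (i ∈ A ↔ i ∈ B) := by
      by_contra hcon
      push Not at hcon
      exact hAB (Finset.ext hcon)
    obtain ⟨i, hi⟩ := this
    refine Finset.prod_eq_zero (Finset.mem_univ i) ?_
    by_cases h1 : i ∈ A <;> by_cases h2 : i ∈ B <;> simp [h1, h2] at hi ⊢
    · exact expect_sg S
    · exact expect_sg S'

lemma expect_chi_one {k L : ℕ} (hL : 0 < L) (A : Finset (Fin k)) (hA : A.Nonempty) (S : Om L) :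
    𝔼 t : Fin k → Fin (4 * L), chi A t S = 0 := by
  have := expect_chi hL A ∅ S S
  rw [if_neg hA.ne_empty] at this
  simpa [chi] using this

lemma expect_fam {k L : ℕ} (hL : 0 < L) (F G : Finset (Finset (Fin k)))
    (hGF : G ⊆ F) (hF : ∀ A ∈ F, A.Nonempty) (S S' : Om L) :
    𝔼 t : Fin k → Fin (4 * L), (∑ A ∈ F, chi A t S) * (∑ B ∈ G, chi B t S') =
      ∑ A ∈ G, ov S S' ^ A.card := by
  simp only [Finset.sum_mul_sum]
  rw [Finset.expect_sum_comm]
  simp only [Finset.expect_sum_comm, expect_chi hL, Finset.sum_ite_eq]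
  rw [Finset.sum_ite_mem, Finset.inter_eq_right.2 hGF]

lemma expect_fam_one {k L : ℕ} (hL : 0 < L) (F : Finset (Finset (Fin k)))
    (hF : ∀ A ∈ F, A.Nonempty) (S : Om L) :
    𝔼 t : Fin k → Fin (4 * L), (∑ A ∈ F, chi A t S) = 0 := by
  rw [Finset.expect_sum_comm]
  exact Finset.sum_eq_zero fun A hA => expect_chi_one hL A (hF A hA) S

/-- nonempty even subsets of positions -/
def EV (k : ℕ) : Finset (Finset (Fin k)) := Finset.univ.filter fun A => A.Nonempty ∧ Even A.card
/-- pairs of positions -/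
def PR (k : ℕ) : Finset (Finset (Fin k)) := Finset.univ.filter fun A => A.card = 2

lemma PR_sub (k : ℕ) : PR k ⊆ EV k := by
  intro A hA
  simp only [PR, EV, Finset.mem_filter, Finset.mem_univ, true_and] at hA ⊢
  exact ⟨Finset.card_pos.1 (by omega), by rw [hA]; exact even_two⟩

lemma EV_ne (k : ℕ) : ∀ A ∈ EV k, A.Nonempty := fun A hA => by
  simp only [EV, Finset.mem_filter, Finset.mem_univ, true_and] at hA; exact hA.1

lemma sum_all (k : ℕ) (x : ℝ) : ∑ A : Finset (Fin k), x ^ A.card = (1 + x) ^ k := by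
  have := Finset.prod_one_add (f := fun _ : Fin k => x) Finset.univ
  simpa using this.symm

lemma sum_EV (k : ℕ) (x : ℝ) :
    ∑ A ∈ EV k, x ^ A.card = ((1 + x) ^ k + (1 - x) ^ k) / 2 - 1 := by
  rw [sub_eq_add_neg 1 x, ← sum_all k x, ← sum_all k (-x), ← Finset.sum_add_distrib, Finset.sum_div,
    EV, Finset.sum_filter]
  have h : ∀ A : Finset (Fin k), (if A.Nonempty ∧ Even A.card then x ^ A.card else 0) =
      (x ^ A.card + (-x) ^ A.card) / 2 - (if A = ∅ then 1 else 0) := by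
    intro A
    by_cases hA : A = ∅
    · subst hA; simp
    · have hA' : A.Nonempty := Finset.nonempty_iff_ne_empty.2 hA
      by_cases he : Even A.card
      · simp [hA, hA', he, he.neg_pow]
      · rw [Nat.not_even_iff_odd] at he
        simp [hA, he.neg_pow, Nat.not_even_iff_odd.2 he]
  simp only [h, Finset.sum_sub_distrib]
  simp

lemma sum_PR (k : ℕ) (x : ℝ) : ∑ A ∈ PR k, x ^ A.card = (PR k).card * x ^ 2 := by
  rw [← nsmul_eq_mul, ← Finset.sum_const]
  refine Finset.sum_congr rfl fun A hA => ?_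
  simp only [PR, Finset.mem_filter, Finset.mem_univ, true_and] at hA
  rw [hA]

lemma card_PR (k : ℕ) : (PR k).card = k.choose 2 := by
  have : PR k = Finset.powersetCard 2 Finset.univ := by
    ext A; simp [PR]
  rw [this]; simp

/-- the hard weight -/
noncomputable def xw {k L : ℕ} (a : ℝ) (t : Fin k → Fin (4 * L)) (S : Om L) : ℝ :=
  1 - a * ∑ A ∈ EV k, chi A t S
/-- the soft perturbation -/
noncomputable def et {k L : ℕ} (a : ℝ) (t : Fin k → Fin (4 * L)) (S : Om L) : ℝ :=
  - (a * ∑ A ∈ PR k, chi A t S)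

lemma abs_chi {k L : ℕ} (A : Finset (Fin k)) (t : Fin k → Fin (4 * L)) (S : Om L) :
    |chi A t S| = 1 := by
  unfold chi
  rw [Finset.abs_prod]
  refine Finset.prod_eq_one fun i _ => ?_
  unfold sg; split_ifs <;> simp

lemma abs_et {k L : ℕ} (a : ℝ) (ha : 0 ≤ a) (hak : a * (k.choose 2) ≤ 1 / 2)
    (t : Fin k → Fin (4 * L)) (S : Om L) : |et a t S| ≤ 1 / 2 := by
  unfold et
  rw [abs_neg, abs_mul, abs_of_nonneg ha]
  refine le_trans (mul_le_mul_of_nonneg_left ?_ ha) hak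
  refine (Finset.abs_sum_le_sum_abs _ _).trans ?_
  simp [abs_chi, card_PR]

lemma expect_et {k L : ℕ} (hL : 0 < L) (a : ℝ) (S : Om L) :
    𝔼 t : Fin k → Fin (4 * L), et a t S = 0 := by
  unfold et
  rw [Finset.expect_neg_distrib, ← Finset.mul_expect,
    expect_fam_one hL _ fun A hA => EV_ne k A (PR_sub k hA)]
  simp

lemma expect_et_et {k L : ℕ} (hL : 0 < L) (a : ℝ) (S S' : Om L) :
    𝔼 t : Fin k → Fin (4 * L), et a t S * et a t S' = a ^ 2 * (k.choose 2) * ov S S' ^ 2 := by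
  have h : ∀ t : Fin k → Fin (4 * L), et a t S * et a t S' =
      a ^ 2 * ((∑ A ∈ PR k, chi A t S) * (∑ A ∈ PR k, chi A t S')) := fun t => by
    unfold et; ring
  simp only [h]
  rw [← Finset.mul_expect, expect_fam hL _ _ subset_rfl fun A hA => EV_ne k A (PR_sub k hA), sum_PR,
    card_PR]
  ring

lemma expect_xw_xw {k L : ℕ} (hL : 0 < L) (a : ℝ) (S S' : Om L) :
    𝔼 t : Fin k → Fin (4 * L), xw a t S * xw a t S' =
      1 + a ^ 2 * (((1 + ov S S') ^ k + (1 - ov S S') ^ k) / 2 - 1) := by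
  haveI : Nonempty (Fin (4 * L)) := ⟨⟨0, by omega⟩⟩
  have h : ∀ t : Fin k → Fin (4 * L), xw a t S * xw a t S' =
      1 - a * (∑ A ∈ EV k, chi A t S) - a * (∑ A ∈ EV k, chi A t S') +
      a ^ 2 * ((∑ A ∈ EV k, chi A t S) * (∑ A ∈ EV k, chi A t S')) := fun t => by
    unfold xw; ring
  simp only [h, Finset.expect_add_distrib, Finset.expect_sub_distrib, ← Finset.mul_expect]
  rw [expect_fam hL _ _ subset_rfl (EV_ne k), sum_EV, expect_fam_one hL _ (EV_ne k),
    expect_fam_one hL _ (EV_ne k)]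
  simp

lemma expect_xw_et {k L : ℕ} (hL : 0 < L) (a : ℝ) (S S' : Om L) :
    𝔼 t : Fin k → Fin (4 * L), xw a t S * (1 + et a t S') =
      1 + a ^ 2 * (k.choose 2) * ov S S' ^ 2 := by
  haveI : Nonempty (Fin (4 * L)) := ⟨⟨0, by omega⟩⟩
  have h : ∀ t : Fin k → Fin (4 * L), xw a t S * (1 + et a t S') =
      1 - a * (∑ A ∈ EV k, chi A t S) - a * (∑ A ∈ PR k, chi A t S') +
      a ^ 2 * ((∑ A ∈ EV k, chi A t S) * (∑ A ∈ PR k, chi A t S')) := fun t => by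
    unfold xw et; ring
  simp only [h, Finset.expect_add_distrib, Finset.expect_sub_distrib, ← Finset.mul_expect]
  rw [expect_fam hL _ _ (PR_sub k) (EV_ne k), sum_PR, card_PR, expect_fam_one hL _ (EV_ne k),
    expect_fam_one hL _ fun A hA => EV_ne k A (PR_sub k hA)]
  simp
  ring

/-- colourability of a tuple hypergraph -/
def TC {N k m : ℕ} (e : Fin m → Fin k → Fin N) : Prop :=
  ∃ c : Fin N → Bool, ∀ i, ∃ u v, c (e i u) ≠ c (e i v)

lemma TC_of_PF {k L m : ℕ} (hk : 2 ≤ k) (a : ℝ) (ha : a * ((2:ℝ) ^ (k - 1) - 1) = 1)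
    (e : Fin m → Fin k → Fin (4 * L)) (h : PF (xw (k := k) (L := L) a) e ≠ 0) : TC e := by
  obtain ⟨S, -, hS⟩ := Finset.exists_ne_zero_of_expect_ne_zero h
  refine ⟨fun v => decide (v ∈ S.1), fun i => ?_⟩
  by_contra hcon
  push Not at hcon
  refine hS (Finset.prod_eq_zero (Finset.mem_univ i) ?_)
  have hc : ∀ A ∈ EV k, chi A (e i) S = 1 ^ A.card := by
    intro A hA
    simp only [EV, Finset.mem_filter, Finset.mem_univ, true_and] at hA
    have h0 : ∀ u, sg S (e i u) = sg S (e i ⟨0, by omega⟩) := by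
      intro u
      have := hcon u ⟨0, by omega⟩
      simp only [decide_eq_decide] at this
      simp only [sg, this]
    unfold chi
    rw [Finset.prod_congr rfl fun u _ => h0 u, Finset.prod_const, one_pow]
    unfold sg; split_ifs
    · simp
    · exact hA.2.neg_one_pow
  unfold xw
  rw [Finset.sum_congr rfl hc, sum_EV]
  obtain ⟨j, rfl⟩ : ∃ j, k = j + 1 := ⟨k - 1, by omega⟩
  simp at ha ⊢
  have : ((1:ℝ) + 1) ^ (j + 1) / 2 - 1 = 2 ^ j - 1 := by rw [pow_succ]; norm_num
  rw [this]; linarith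

lemma expect_ov_le {L : ℕ} (hL : 0 < L) (S : Om L) (F : ℝ → ℝ)
    (hF : ∀ j ≤ 2 * L, 0 ≤ F (((j : ℝ) - L) / L)) :
    𝔼 S' : Om L, F (ov S S') ≤ ∑ j ∈ Finset.range (2 * L + 1),
      ((2 * L).choose j : ℝ) ^ 2 / ((4 * L).choose (2 * L)) * F (((j : ℝ) - L) / L) := by
  rw [Fintype.expect_eq_sum_div_card, card_Om]
  have hmaps : ∀ S' ∈ (Finset.univ : Finset (Om L)), (S.1 ∩ S'.1).card ∈ Finset.range (2 * L + 1) := by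
    intro S' _
    have := Finset.card_le_card (Finset.inter_subset_left (s₁ := S.1) (s₂ := S'.1))
    rw [S.2] at this
    simp; omega
  rw [← Finset.sum_fiberwise_of_maps_to hmaps, Finset.sum_div]
  refine Finset.sum_le_sum fun j hj => ?_
  have hj' : j ≤ 2 * L := by simp at hj; omega
  rw [Finset.sum_congr rfl (g := fun _ => F (((j : ℝ) - L) / L)) fun S' hS' => by
    rw [ov_eq hL]; simp at hS'; rw [hS'], Finset.sum_const, nsmul_eq_mul]
  rw [mul_div_right_comm]
  refine mul_le_mul_of_nonneg_right (div_le_div_of_nonneg_right ?_ (by positivity)) (hF j hj')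
  have : (Finset.univ.filter fun S' : Om L => (S.1 ∩ S'.1).card = j).card ≤
      (Finset.powersetCard j S.1 ×ˢ Finset.powersetCard (2 * L - j) S.1ᶜ).card := by
    refine Finset.card_le_card_of_injOn (fun S' => (S.1 ∩ S'.1, S.1ᶜ ∩ S'.1)) ?_ ?_
    · intro S' hS'
      simp at hS'
      simp only [Finset.coe_product, Set.mem_prod, Finset.mem_coe, Finset.mem_powersetCard]
      refine ⟨⟨Finset.inter_subset_left, hS'⟩, Finset.inter_subset_left, ?_⟩
      have h1 : (S'.1 ∩ S.1).card + (S'.1 \ S.1).card = S'.1.card := Finset.card_inter_add_card_sdiff _ _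
      have h2 : S.1ᶜ ∩ S'.1 = S'.1 \ S.1 := by ext v; simp [and_comm]
      rw [h2]
      rw [Finset.inter_comm] at hS'
      have := S'.2
      omega
    · intro S₁ _ S₂ _ h
      simp only [Prod.mk.injEq] at h
      apply Subtype.ext
      ext v
      have e1 := Finset.ext_iff.1 h.1 v
      have e2 := Finset.ext_iff.1 h.2 v
      simp at e1 e2
      tauto
  rw [Finset.card_product, Finset.card_powersetCard, Finset.card_powersetCard, S.2, Finset.card_compl,
    S.2, Fintype.card_fin, show 4 * L - 2 * L = 2 * L by omega, Nat.choose_symm hj'] at this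
  rw [sq]; exact_mod_cast this

end Concrete
end HG

namespace HG

section Binom

lemma cb_upper (L : ℕ) : (2 * (L:ℝ) + 1) * (Nat.centralBinom L : ℝ) ^ 2 ≤ 16 ^ L := by
  induction L with
  | zero => simp
  | succ L ih =>
    have h : ((L:ℝ) + 1) * (Nat.centralBinom (L + 1) : ℝ) = 2 * (2 * L + 1) * Nat.centralBinom L := by
      exact_mod_cast Nat.succ_mul_centralBinom_succ L
    have h' : (Nat.centralBinom (L + 1) : ℝ) = 2 * (2 * L + 1) * Nat.centralBinom L / (L + 1) := by
      field_simp; linarith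
    rw [h', pow_succ (16:ℝ) L]
    push_cast
    have e : (2 * ((L:ℝ) + 1) + 1) * (2 * (2 * L + 1) * (Nat.centralBinom L : ℝ) / (L + 1)) ^ 2 =
      4 * ((2 * (L:ℝ) + 3) * (2 * L + 1)) / (L + 1) ^ 2 * ((2 * L + 1) * (Nat.centralBinom L : ℝ) ^ 2) := by
      field_simp; ring
    rw [e, mul_comm ((16:ℝ) ^ L)]
    refine mul_le_mul ?_ ih (by positivity) (by norm_num)
    rw [div_le_iff₀ (by positivity)]
    nlinarith

lemma cb_lower (L : ℕ) (hL : 1 ≤ L) : (16:ℝ) ^ L ≤ 4 * L * (Nat.centralBinom L : ℝ) ^ 2 := by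
  induction L, hL using Nat.le_induction with
  | base => simp [Nat.centralBinom]; norm_num
  | succ L hL ih =>
    have h : ((L:ℝ) + 1) * (Nat.centralBinom (L + 1) : ℝ) = 2 * (2 * L + 1) * Nat.centralBinom L := by
      exact_mod_cast Nat.succ_mul_centralBinom_succ L
    have h' : (Nat.centralBinom (L + 1) : ℝ) = 2 * (2 * L + 1) * Nat.centralBinom L / (L + 1) := by
      field_simp; linarith
    have hL0 : (0:ℝ) < L := by exact_mod_cast hL
    rw [h', pow_succ (16:ℝ) L]
    push_cast
    have e : (4 * ((L:ℝ) + 1)) * (2 * (2 * L + 1) * (Nat.centralBinom L : ℝ) / (L + 1)) ^ 2 =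
      (4 * (2 * (L:ℝ) + 1) ^ 2 / (L * (L + 1))) * (4 * L * (Nat.centralBinom L : ℝ) ^ 2) := by
      field_simp; norm_num
    rw [e, mul_comm ((16:ℝ) ^ L)]
    refine mul_le_mul ?_ ih (by positivity) (by positivity)
    rw [le_div_iff₀ (by positivity)]
    nlinarith

lemma ratio_exp {x : ℝ} (h0 : 0 ≤ x) (h1 : x < 1) : (1 - x) / (1 + x) ≤ Real.exp (-(2 * x)) := by
  have hs := Real.hasSum_log_sub_log_of_abs_lt_one (x := x) (by rw [abs_of_nonneg h0]; exact h1)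
  have h2 := le_hasSum hs 0 (fun i _ => by positivity)
  simp at h2
  have h3 : Real.log ((1 - x) / (1 + x)) ≤ -(2 * x) := by
    rw [Real.log_div (by linarith) (by linarith)]; linarith
  rwa [Real.log_le_iff_le_exp (div_pos (by linarith) (by linarith))] at h3

lemma choose_gauss (L d : ℕ) : ((2 * L).choose (L + d) : ℝ) ≤
    (Nat.centralBinom L : ℝ) * Real.exp (-((d:ℝ) ^ 2 / (L + 1 / 2))) := by
  induction d with
  | zero => simp [Nat.centralBinom]
  | succ d ih =>
    rcases le_or_gt L d with h | h
    · rw [Nat.choose_eq_zero_of_lt (by omega)]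
      simp only [Nat.cast_zero]; positivity
    · have h1 := Nat.choose_succ_right_eq (2 * L) (L + d)
      have h2 : (2 * L - (L + d) : ℕ) = L - d := by omega
      rw [h2] at h1
      have h3 : ((2 * L).choose (L + d + 1) : ℝ) * (L + d + 1) = (2 * L).choose (L + d) * (L - d) := by
        have : (((2 * L).choose (L + d + 1) * (L + d + 1) : ℕ) : ℝ) =
          (((2 * L).choose (L + d) * (L - d) : ℕ) : ℝ) := by rw [h1]
        push_cast [Nat.cast_sub h.le] at this
        linarith
      have hdL : (d:ℝ) + 1 ≤ L := by exact_mod_cast h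
      have hd0 : (0:ℝ) ≤ d := Nat.cast_nonneg d
      have h4 : ((2 * L).choose (L + (d + 1)) : ℝ) = (2 * L).choose (L + d) * ((L - d) / (L + d + 1)) := by
        rw [← add_assoc]
        field_simp
        linarith
      have hr := ratio_exp (x := ((d:ℝ) + 1 / 2) / (L + 1 / 2)) (by positivity)
        (by rw [div_lt_one (by positivity)]; linarith)
      have e : (1 - ((d:ℝ) + 1 / 2) / (L + 1 / 2)) / (1 + ((d:ℝ) + 1 / 2) / (L + 1 / 2)) =
          (L - d) / (L + d + 1) := by
        have p1 : (L:ℝ) + 1 / 2 ≠ 0 := by positivity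
        have e1 : 1 - ((d:ℝ) + 1 / 2) / (L + 1 / 2) = (L - d) / (L + 1 / 2) := by
          rw [eq_div_iff p1, sub_mul, div_mul_cancel₀ _ p1]; ring
        have e2 : 1 + ((d:ℝ) + 1 / 2) / (L + 1 / 2) = (L + d + 1) / (L + 1 / 2) := by
          rw [eq_div_iff p1, add_mul, div_mul_cancel₀ _ p1]; ring
        rw [e1, e2, div_div_div_cancel_right₀ p1]
      rw [e] at hr
      rw [h4]
      calc ((2 * L).choose (L + d) : ℝ) * ((L - d) / (L + d + 1)) ≤
          (Nat.centralBinom L * Real.exp (-((d:ℝ) ^ 2 / (L + 1 / 2)))) *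
            Real.exp (-(2 * (((d:ℝ) + 1 / 2) / (L + 1 / 2)))) := by
            refine mul_le_mul ih hr (div_nonneg (by linarith) (by positivity)) (by positivity)
        _ = _ := by
            rw [mul_assoc, ← Real.exp_add]
            congr 2
            push_cast
            field_simp; ring

lemma choose_gauss' (L j : ℕ) (hj : j ≤ 2 * L) : ((2 * L).choose j : ℝ) ≤
    (Nat.centralBinom L : ℝ) * Real.exp (-(((j:ℝ) - L) ^ 2 / (L + 1 / 2))) := by
  rcases le_total L j with h | h
  · obtain ⟨d, rfl⟩ := Nat.exists_eq_add_of_le h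
    have := choose_gauss L d
    push_cast; simpa using this
  · obtain ⟨d, hd⟩ := Nat.exists_eq_add_of_le h
    have := choose_gauss L d
    rw [← Nat.choose_symm hj, show 2 * L - j = L + d by omega]
    have e : ((j:ℝ) - L) ^ 2 = (d:ℝ) ^ 2 := by rw [hd]; push_cast; ring
    rw [e]; exact this

/-- overlap weights -/
noncomputable def pw (L j : ℕ) : ℝ := ((2 * L).choose j : ℝ) ^ 2 / ((4 * L).choose (2 * L))

lemma pw_nonneg (L j : ℕ) : 0 ≤ pw L j := by unfold pw; positivity

lemma D_lower (L : ℕ) (hL : 1 ≤ L) : (16:ℝ) ^ L ≤ Real.sqrt (8 * L) * ((4 * L).choose (2 * L)) := by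
  have h := cb_lower (2 * L) (by omega)
  rw [Nat.centralBinom, show 2 * (2 * L) = 4 * L by ring] at h
  refine le_of_sq_le_sq₀ ?_ (by positivity)
  rw [mul_pow, Real.sq_sqrt (by positivity), ← pow_mul, mul_comm L 2]
  push_cast at h
  linarith
where
  le_of_sq_le_sq₀ {a b : ℝ} (h : a ^ 2 ≤ b ^ 2) (hb : 0 ≤ b) : a ≤ b := by
    exact le_of_sq_le_sq h hb
  le_of_sq_le_sq {a b : ℝ} (h : a ^ 2 ≤ b ^ 2) (hb : 0 ≤ b) : a ≤ b := by
    nlinarith [abs_le_of_sq_le_sq h hb, le_abs_self a]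

lemma pw_le (L j : ℕ) (hL : 2 ≤ L) (hj : j ≤ 2 * L) :
    pw L j ≤ 2 / Real.sqrt L * Real.exp (-(3 / 2 * L * (((j:ℝ) - L) / L) ^ 2)) := by
  have hL0 : (2:ℝ) ≤ L := by exact_mod_cast hL
  have hLp : (0:ℝ) < L := by linarith
  have hD := D_lower L (by omega)
  have hDp : (0:ℝ) < ((4 * L).choose (2 * L) : ℝ) := by
    exact_mod_cast Nat.choose_pos (by omega)
  unfold pw
  rw [div_le_iff₀ hDp]
  have h1 := choose_gauss' L j hj
  have h2 := cb_upper L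
  have hs : Real.sqrt (8 * L) = Real.sqrt 8 * Real.sqrt L := Real.sqrt_mul (by norm_num) _
  have hsL : 0 < Real.sqrt L := Real.sqrt_pos.2 hLp
  have hs8 : Real.sqrt 8 ≤ 4 := by rw [Real.sqrt_le_left (by norm_num)]; norm_num
  have hsq : Real.sqrt L ^ 2 = L := Real.sq_sqrt hLp.le
  have h3 : ((2 * L).choose j : ℝ) ^ 2 ≤ (Nat.centralBinom L : ℝ) ^ 2 *
      Real.exp (-(3 / 2 * L * (((j:ℝ) - L) / L) ^ 2)) := by
    calc ((2 * L).choose j : ℝ) ^ 2 ≤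
      ((Nat.centralBinom L : ℝ) * Real.exp (-(((j:ℝ) - L) ^ 2 / (L + 1 / 2)))) ^ 2 := by
          gcongr
      _ = (Nat.centralBinom L : ℝ) ^ 2 * Real.exp (-(2 * (((j:ℝ) - L) ^ 2 / (L + 1 / 2)))) := by
          rw [mul_pow, ← Real.exp_nat_mul]; congr 2; push_cast; ring
      _ ≤ _ := by
          refine mul_le_mul_of_nonneg_left (Real.exp_le_exp.2 (neg_le_neg ?_)) (by positivity)
          rw [div_pow, show 3 / 2 * (L:ℝ) * (((j:ℝ) - L) ^ 2 / L ^ 2) = ((j:ℝ) - L) ^ 2 * (3 / 2 / L) by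
            field_simp, show 2 * (((j:ℝ) - L) ^ 2 / (L + 1 / 2)) = ((j:ℝ) - L) ^ 2 * (2 / (L + 1 / 2)) by ring]
          refine mul_le_mul_of_nonneg_left ?_ (sq_nonneg _)
          rw [div_le_div_iff₀ hLp (by linarith)]; linarith
  have h4 : (Nat.centralBinom L : ℝ) ^ 2 ≤ 2 / Real.sqrt L * ((4 * L).choose (2 * L)) := by
    have h5 : (Nat.centralBinom L : ℝ) ^ 2 * (2 * L) ≤ 4 * Real.sqrt L * ((4 * L).choose (2 * L)) := by
      have a1 : (Nat.centralBinom L : ℝ) ^ 2 * (2 * L) ≤ 16 ^ L := by nlinarith [sq_nonneg (Nat.centralBinom L : ℝ)]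
      have a2 : Real.sqrt 8 * Real.sqrt L * ((4 * L).choose (2 * L)) ≤ 4 * Real.sqrt L * ((4 * L).choose (2 * L)) := by
        gcongr
      rw [hs] at hD
      linarith
    rw [div_mul_eq_mul_div, le_div_iff₀ hsL]
    have : (Nat.centralBinom L : ℝ) ^ 2 * Real.sqrt L * (2 * Real.sqrt L) ≤
       2 * ((4 * L).choose (2 * L)) * (2 * Real.sqrt L) := by nlinarith
    exact le_of_mul_le_mul_right this (by positivity)
  calc ((2 * L).choose j : ℝ) ^ 2 ≤ _ := h3
    _ ≤ (2 / Real.sqrt L * ((4 * L).choose (2 * L))) * Real.exp (-(3 / 2 * L * (((j:ℝ) - L) / L) ^ 2)) := by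
        gcongr
    _ = _ := by ring

lemma choose_exp (n j : ℕ) (κ : ℝ) : (n.choose j : ℝ) ≤ Real.exp (κ * j + n * Real.exp (-κ)) := by
  have h1 : (n.choose j : ℝ) * Real.exp (-κ) ^ j ≤ (1 + Real.exp (-κ)) ^ n := by
    rcases le_or_gt j n with hj | hj
    · rw [add_comm, add_pow]
      have := Finset.single_le_sum (f := fun i => Real.exp (-κ) ^ i * 1 ^ (n - i) * (n.choose i : ℝ))
        (s := Finset.range (n + 1)) (fun i _ => by positivity) (Finset.mem_range.2 (Nat.lt_succ_of_le hj))
      simp only [one_pow, mul_one] at this ⊢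
      linarith
    · rw [Nat.choose_eq_zero_of_lt hj]; simp; positivity
  have h2 : (1 + Real.exp (-κ)) ^ n ≤ Real.exp (n * Real.exp (-κ)) := by
    rw [Real.exp_nat_mul]
    gcongr
    have := Real.add_one_le_exp (Real.exp (-κ)); linarith
  have h3 : Real.exp (-κ) ^ j = (Real.exp (κ * j))⁻¹ := by
    rw [← Real.exp_neg, ← Real.exp_nat_mul]; congr 1; ring
  rw [h3, ← div_eq_mul_inv, div_le_iff₀ (Real.exp_pos _)] at h1
  rw [Real.exp_add]
  nlinarith [Real.exp_pos (κ * j)]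

lemma pw_far (L j : ℕ) (hL : 1 ≤ L) (κ x : ℝ) (hx : (j:ℝ) = 2 * L * x) :
    pw L j ≤ Real.sqrt (8 * L) * Real.exp (4 * L * (κ * x + Real.exp (-κ) - Real.log 2)) := by
  have hDp : (0:ℝ) < ((4 * L).choose (2 * L) : ℝ) := by
    exact_mod_cast Nat.choose_pos (by omega)
  have hD := D_lower L hL
  unfold pw
  rw [div_le_iff₀ hDp]
  have h1 := choose_exp (2 * L) j κ
  have e1 : Real.exp (4 * L * (κ * x + Real.exp (-κ) - Real.log 2)) =
      Real.exp (κ * j + (2 * L : ℕ) * Real.exp (-κ)) ^ 2 / 16 ^ L := by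
    rw [show (16:ℝ) ^ L = Real.exp (4 * L * Real.log 2) by
      rw [show (16:ℝ) = 2 ^ 4 by norm_num, ← pow_mul, mul_comm, ← Real.rpow_natCast,
        Real.rpow_def_of_pos (by norm_num)]
      congr 1; push_cast; ring, ← Real.exp_nat_mul, ← Real.exp_sub]
    congr 1
    rw [hx]; push_cast; ring
  rw [e1]
  have h2 : ((2 * L).choose j : ℝ) ^ 2 ≤ Real.exp (κ * j + (2 * L : ℕ) * Real.exp (-κ)) ^ 2 := by
    gcongr
  have h16 : (0:ℝ) < 16 ^ L := by positivity
  have : Real.sqrt (8 * L) * (Real.exp (κ * j + (2 * L : ℕ) * Real.exp (-κ)) ^ 2 / 16 ^ L) *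
      ((4 * L).choose (2 * L)) = Real.exp (κ * j + (2 * L : ℕ) * Real.exp (-κ)) ^ 2 *
      ((Real.sqrt (8 * L) * ((4 * L).choose (2 * L))) / 16 ^ L) := by ring
  rw [this]
  have h3 : 1 ≤ (Real.sqrt (8 * L) * ((4 * L).choose (2 * L))) / 16 ^ L := by
    rw [le_div_iff₀ h16]; linarith
  nlinarith [sq_nonneg (Real.exp (κ * j + (2 * L : ℕ) * Real.exp (-κ)))]

lemma pw_symm (L j : ℕ) (hj : j ≤ 2 * L) : pw L (2 * L - j) = pw L j := by
  unfold pw; rw [Nat.choose_symm hj]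

lemma geo_sum (ρ : ℝ) (h0 : 0 ≤ ρ) (h1 : ρ < 1) (n : ℕ) : ∑ i ∈ Finset.range n, ρ ^ i ≤ 1 / (1 - ρ) := by
  rw [one_div, ← tsum_geometric_of_lt_one h0 h1]
  exact (summable_geometric_of_lt_one h0 h1).sum_le_tsum _ (fun i _ => by positivity)

lemma gauss_sum (L : ℕ) (hL : 2 ≤ L) :
    ∑ j ∈ Finset.range (2 * L + 1), Real.exp (-(1 / 2 * L * (((j:ℝ) - L) / L) ^ 2)) ≤
      8 * Real.sqrt L := by
  have hL0 : (2:ℝ) ≤ L := by exact_mod_cast hL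
  have hLp : (0:ℝ) < L := by linarith
  have hsL : 1 ≤ Real.sqrt L := by rw [Real.one_le_sqrt]; linarith
  have hsq : Real.sqrt L ^ 2 = L := Real.sq_sqrt hLp.le
  set s := Real.sqrt L with hs
  set ρ := Real.exp (-(1 / s)) with hρ
  have hρ0 : 0 ≤ ρ := (Real.exp_pos _).le
  have hsp : 0 < s := by linarith
  have hρ1 : ρ ≤ s / (1 + s) := by
    rw [hρ, Real.exp_neg, ← one_div, div_le_div_iff₀ (Real.exp_pos _) (by linarith)]
    have := Real.add_one_le_exp (1 / s)
    have e : s * (1 / s + 1) = 1 + s := by field_simp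
    nlinarith
  have hρ2 : ρ < 1 := lt_of_le_of_lt hρ1 (by rw [div_lt_one (by linarith)]; linarith)
  have hg : 1 / (1 - ρ) ≤ 2 * s := by
    rw [div_le_iff₀ (by linarith)]
    have : 1 - ρ ≥ 1 / (1 + s) := by
      have : 1 - s / (1 + s) = 1 / (1 + s) := by field_simp; ring
      linarith
    have : 2 * s * (1 / (1 + s)) ≤ 2 * s * (1 - ρ) := by gcongr
    have : 1 ≤ 2 * s * (1 / (1 + s)) := by
      rw [mul_one_div, le_div_iff₀ (by linarith)]; linarith
    linarith
  have hpt : ∀ (z : ℝ) (d : ℕ), z ^ 2 = (d:ℝ) ^ 2 → Real.exp (-(1 / 2 * L * (z / L) ^ 2)) ≤ 2 * ρ ^ d := by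
    intro z d hz
    have h1 : Real.exp (1 / 2) ≤ 2 := by
      have := Real.exp_one_lt_d9
      have h2 : Real.exp (1 / 2) ^ 2 = Real.exp 1 := by rw [← Real.exp_nat_mul]; norm_num
      nlinarith [Real.exp_pos (1/2)]
    calc Real.exp (-(1 / 2 * L * (z / L) ^ 2)) ≤ Real.exp (1 / 2 + d * (-(1 / s))) := by
          apply Real.exp_le_exp.2
          rw [div_pow, hz, ← hsq]
          have : 1 / 2 + (d:ℝ) * (-(1 / s)) + 1 / 2 * s ^ 2 * ((d:ℝ) ^ 2 / (s ^ 2) ^ 2) =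
            1 / 2 * (1 - d / s) ^ 2 := by field_simp; ring
          have h3 := sq_nonneg (1 - (d:ℝ) / s)
          linarith
      _ = Real.exp (1 / 2) * ρ ^ d := by rw [Real.exp_add, hρ, ← Real.exp_nat_mul]
      _ ≤ 2 * ρ ^ d := by gcongr
  rw [show 2 * L + 1 = L + (L + 1) by ring, Finset.sum_range_add, ← Finset.sum_range_reflect]
  have p1 : ∑ j ∈ Finset.range L, Real.exp (-(1 / 2 * L * ((((L - 1 - j : ℕ):ℝ) - L) / L) ^ 2)) ≤
      ∑ j ∈ Finset.range L, 2 * ρ ^ j := by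
    refine Finset.sum_le_sum fun j hj => ?_
    have hj' : j < L := Finset.mem_range.1 hj
    refine (hpt _ (j + 1) ?_).trans ?_
    · rw [Nat.cast_sub (by omega), Nat.cast_sub (by omega)]; push_cast; ring
    · rw [pow_succ]
      have : 0 ≤ ρ ^ j := by positivity
      nlinarith
  have p2 : ∑ j ∈ Finset.range (L + 1), Real.exp (-(1 / 2 * L * ((((L + j : ℕ):ℝ) - L) / L) ^ 2)) ≤
      ∑ j ∈ Finset.range (L + 1), 2 * ρ ^ j := by
    refine Finset.sum_le_sum fun j hj => hpt _ j ?_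
    push_cast; ring
  have g1 := geo_sum ρ hρ0 hρ2 L
  have g2 := geo_sum ρ hρ0 hρ2 (L + 1)
  rw [← Finset.mul_sum] at p1 p2
  linarith

lemma sum_R1 (L : ℕ) (hL : 2 ≤ L) :
    ∑ j ∈ Finset.range (2 * L + 1), pw L j * Real.exp (L * (((j:ℝ) - L) / L) ^ 2) ≤ 16 := by
  have hL0 : (2:ℝ) ≤ L := by exact_mod_cast hL
  have hLp : (0:ℝ) < L := by linarith
  have hsp : 0 < Real.sqrt L := Real.sqrt_pos.2 hLp
  calc _ ≤ ∑ j ∈ Finset.range (2 * L + 1), 2 / Real.sqrt L * Real.exp (-(1 / 2 * L * (((j:ℝ) - L) / L) ^ 2)) := by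
        refine Finset.sum_le_sum fun j hj => ?_
        have := pw_le L j hL (by simp at hj; omega)
        calc _ ≤ 2 / Real.sqrt L * Real.exp (-(3 / 2 * L * (((j:ℝ) - L) / L) ^ 2)) *
            Real.exp (L * (((j:ℝ) - L) / L) ^ 2) := by gcongr
          _ = _ := by
            rw [mul_assoc, ← Real.exp_add]; congr 2; ring
    _ ≤ 2 / Real.sqrt L * (8 * Real.sqrt L) := by
        rw [← Finset.mul_sum]
        exact mul_le_mul_of_nonneg_left (gauss_sum L hL) (by positivity)
    _ = 16 := by field_simp; norm_num

end Binom
end HG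

namespace HG

section Numerics

/-- conditions on `k`, `y = 2^(1-k)`, satisfied for large `k` -/
structure Good (ε : ℝ) (k : ℕ) (y r : ℝ) : Prop where
  he : 0 < ε
  he1 : ε ≤ 1
  hk : 1000 ≤ k
  hke : 16 ≤ ε * k
  hy : 0 < y
  hy2 : y * 2 ^ k = 2
  hyk : y * (k:ℝ) ^ 4 ≤ ε
  h95 : (0.95:ℝ) ^ k ≤ 0.05
  hr : r * y = Real.log 2 - y * (Real.log 2 / 2 + (1 + ε) / 2)

lemma good_exists (ε : ℝ) (he : 0 < ε) (he1 : ε ≤ 1) : ∃ k₀ : ℕ, ∀ k : ℕ, k₀ ≤ k →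
    Good ε k (1 / 2 ^ (k - 1)) ((2 : ℝ) ^ (k - 1) * Real.log 2 - Real.log 2 / 2 - (1 + ε) / 2) := by
  have t1 : ∀ᶠ k : ℕ in atTop, (k:ℝ) ^ 4 * (1 / 2) ^ k < ε / 2 :=
    (tendsto_pow_const_mul_const_pow_of_lt_one 4 (r := 1 / 2) (by norm_num) (by norm_num)).eventually_lt_const
      (by linarith)
  have t2 : ∀ᶠ k : ℕ in atTop, (0.95:ℝ) ^ k < 0.05 :=
    (tendsto_pow_atTop_nhds_zero_of_lt_one (by norm_num) (by norm_num)).eventually_lt_const (by norm_num)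
  obtain ⟨k₁, h₁⟩ := (t1.and t2).exists_forall_of_atTop
  refine ⟨max k₁ (max 1000 ⌈16 / ε⌉₊), fun k hk => ?_⟩
  obtain ⟨a1, a2⟩ := h₁ k (le_trans (le_max_left _ _) hk)
  have hk1 : 1000 ≤ k := le_trans (le_max_left _ _) (le_trans (le_max_right _ _) hk)
  have hk2 : ⌈16 / ε⌉₊ ≤ k := le_trans (le_max_right _ _) (le_trans (le_max_right _ _) hk)
  have hk3 : 16 / ε ≤ k := Nat.ceil_le.1 hk2
  have e2 : (2:ℝ) ^ k = 2 * 2 ^ (k - 1) := by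
    rw [← pow_succ', Nat.sub_add_cancel (by omega)]
  have hp : (0:ℝ) < 2 ^ (k - 1) := by positivity
  refine ⟨he, he1, hk1, ?_, by positivity, ?_, ?_, a2.le, ?_⟩
  · rw [div_le_iff₀ he] at hk3; linarith
  · rw [e2]; field_simp
  · rw [one_div_pow, e2] at a1
    have : (1:ℝ) / 2 ^ (k - 1) * k ^ 4 = 2 * (k ^ 4 * (1 / (2 * 2 ^ (k - 1)))) := by field_simp
    rw [this]; linarith
  · field_simp
    ring

variable {ε y r : ℝ} {k : ℕ}

lemma Good.k0 (g : Good ε k y r) : (1000:ℝ) ≤ k := by exact_mod_cast g.hk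

lemma Good.ysmall (g : Good ε k y r) : y * k ^ 3 ≤ ε / 1000 := by
  have h := g.hyk; have h0 := g.k0; have hy := g.hy
  have : y * (k:ℝ)^3 * 1000 ≤ y * (k:ℝ)^3 * k := by gcongr
  nlinarith

lemma Good.ysmall2 (g : Good ε k y r) : y * k ^ 2 ≤ ε / 1000000 := by
  have h := g.ysmall; have h0 := g.k0; have hy := g.hy
  have : y * (k:ℝ)^2 * 1000 ≤ y * (k:ℝ)^2 * k := by gcongr
  nlinarith

lemma Good.ysmall1 (g : Good ε k y r) : y * k ≤ ε / 1000000000 := by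
  have h := g.ysmall2; have h0 := g.k0; have hy := g.hy
  have : y * (k:ℝ) * 1000 ≤ y * (k:ℝ) * k := by gcongr
  nlinarith

lemma Good.ysmall0 (g : Good ε k y r) : y ≤ ε / 1000000000000 := by
  have h := g.ysmall1; have h0 := g.k0; have hy := g.hy
  have : y * 1000 ≤ y * k := by gcongr
  nlinarith

lemma Good.ry_lower (g : Good ε k y r) : Real.log 2 - 2 * y ≤ r * y := by
  have := Real.log_two_lt_d9
  have := g.he1
  have hy := g.hy
  rw [g.hr]; nlinarith

lemma Good.ry_upper (g : Good ε k y r) : r * y ≤ 0.7 := by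
  have := Real.log_two_lt_d9
  have := Real.log_two_gt_d9
  have := g.he
  have hy := g.hy
  rw [g.hr]; nlinarith

lemma Good.r_pos (g : Good ε k y r) : 0 < r := by
  have h1 := g.ry_lower
  have := Real.log_two_gt_d9
  have h2 := g.ysmall0
  have h3 := g.he1
  have hy := g.hy
  by_contra h
  push Not at h
  nlinarith

lemma Good.r_log (g : Good ε k y r) : r * (-Real.log (1 - y)) ≤ Real.log 2 - y / 2 - 3 * y * ε / 8 := by
  have hy := g.hy
  have h0 := g.ysmall0
  have h1 := g.he1
  have he := g.he
  have hl := Real.log_two_gt_d9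
  have hl' := Real.log_two_lt_d9
  have ha := Real.abs_log_sub_add_sum_range_le (x := y) (by rw [abs_of_pos hy]; linarith) 2
  rw [abs_of_pos hy] at ha
  have hb := (abs_le.1 ha).1
  simp [Finset.sum_range_succ] at hb
  have hc : y ^ 3 / (1 - y) ≤ 2 * y ^ 3 := by
    rw [div_le_iff₀ (by linarith)]
    nlinarith [pow_pos hy 3]
  have hd : -Real.log (1 - y) ≤ y + y ^ 2 / 2 + 2 * y ^ 3 := by
    norm_num at hb
    linarith
  have hrp := g.r_pos
  calc r * (-Real.log (1 - y)) ≤ r * (y + y ^ 2 / 2 + 2 * y ^ 3) := by gcongr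
    _ = (r * y) * (1 + y / 2 + 2 * y ^ 2) := by ring
    _ ≤ _ := by
      rw [g.hr]
      have hyy : y * y ≤ y * (ε / 1000000000000) := by gcongr
      have e : (Real.log 2 - y * (Real.log 2 / 2 + (1 + ε) / 2)) * (1 + y / 2 + 2 * y ^ 2) =
         Real.log 2 - y / 2 - y * ε / 2 + 2 * Real.log 2 * (y * y)
           - y * (Real.log 2 / 2 + (1 + ε) / 2) * (y / 2 + 2 * y ^ 2) := by ring
      rw [e]
      have : 0 ≤ y * (Real.log 2 / 2 + (1 + ε) / 2) * (y / 2 + 2 * y ^ 2) := by positivity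
      have : 2 * Real.log 2 * (y * y) ≤ 2 * (y * y) := by
        gcongr; linarith
      have : 0 < y * ε := by positivity
      linarith

/-- correlation function -/
noncomputable def qf (a : ℝ) (k : ℕ) (R : ℝ) : ℝ := a ^ 2 * (((1 + R) ^ k + (1 - R) ^ k) / 2 - 1)

lemma pow_le_exp_neg {x : ℝ} (hx : x ≤ 1) (k : ℕ) : (1 - x) ^ k ≤ Real.exp (-(k * x)) := by
  have : 1 - x ≤ Real.exp (-x) := by have := Real.add_one_le_exp (-x); linarith
  calc (1 - x) ^ k ≤ (Real.exp (-x)) ^ k := pow_le_pow_left₀ (by linarith) this k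
    _ = _ := by rw [← Real.exp_nat_mul]; congr 1; ring

lemma exp_neg_chord {t : ℝ} (h0 : 0 ≤ t) (h1 : t ≤ 1) : Real.exp (-t) ≤ 1 - 0.6 * t := by
  have h := convexOn_exp.2 (Set.mem_univ (0:ℝ)) (Set.mem_univ (-1:ℝ)) (show 0 ≤ 1 - t by linarith) h0 (by ring)
  simp at h
  have h2 : Real.exp (-1) ≤ 0.4 := by
    rw [Real.exp_neg, inv_le_comm₀ (Real.exp_pos _) (by norm_num)]
    have := Real.exp_one_gt_d9
    norm_num; linarith
  nlinarith

lemma pow_lower2 {x : ℝ} (h0 : 0 ≤ x) (h1 : x ≤ 1) (k : ℕ) :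
    (1 - x) ^ k ≤ 1 - k * x + (k * x) ^ 2 / 2 := by
  induction k with
  | zero => simp
  | succ k ih =>
    rw [pow_succ]
    push_cast
    have h2 : 0 ≤ 1 - x := by linarith
    have h3 : (1 - x) ^ k * (1 - x) ≤ (1 - k * x + (k * x) ^ 2 / 2) * (1 - x) := by gcongr
    have hk : (0:ℝ) ≤ k := by positivity
    have : 0 ≤ (k * x) ^ 2 * x := by positivity
    nlinarith [sq_nonneg x]

set_option maxHeartbeats 2000000 in
lemma Good.far (g : Good ε k y r) (x : ℝ) (h0 : 0 ≤ x) (h1 : x ≤ 0.05) :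
    ∃ κ : ℝ, κ * x + Real.exp (-κ) - Real.log 2 + r * Real.log (1 + qf (y / (1 - y)) k (1 - 2 * x)) ≤
      -(y * ε / 8) := by
  have hy := g.hy
  have hy0 := g.ysmall0
  have he := g.he
  have he1 := g.he1
  have hk := g.k0
  have hl := Real.log_two_gt_d9
  have hl' := Real.log_two_lt_d9
  have hr := g.r_pos
  have hry := g.ry_lower
  have hrl := g.r_log
  have hyk := g.ysmall2
  have hyk1 := g.ysmall1
  set u := (1 - x) ^ k + x ^ k with hu
  have hk2 : 2 ≤ k := by have := g.hk; omega
  have hxk : x ^ k ≤ x ^ 2 := pow_le_pow_of_le_one h0 (by linarith) hk2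
  have hxk0 : 0 ≤ x ^ k := by positivity
  have hu0 : 0 ≤ u := add_nonneg (pow_nonneg (by linarith) _) hxk0
  have hq : 1 + qf (y / (1 - y)) k (1 - 2 * x) = (1 - y)⁻¹ * (1 - y * (1 - u) / (1 - y)) := by
    unfold qf
    have e1 : (1 + (1 - 2 * x)) ^ k + (1 - (1 - 2 * x)) ^ k = 2 ^ k * u := by
      rw [hu, mul_add, ← mul_pow, ← mul_pow]; ring
    have e2 : (2:ℝ) ^ k = 2 / y := by rw [eq_div_iff hy.ne', mul_comm]; exact g.hy2
    rw [e1, e2]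
    have : (1 - y) ≠ 0 := by linarith
    field_simp
    ring
  have hlog : Real.log (1 + qf (y / (1 - y)) k (1 - 2 * x)) ≤ -Real.log (1 - y) - y * (1 - u) / (1 - y) := by
    have h1y : 0 < 1 - y := by linarith
    have hpos : 0 < 1 - y * (1 - u) / (1 - y) := by
      rw [sub_pos, div_lt_one h1y]; nlinarith
    rw [hq, Real.log_mul (by positivity) hpos.ne', Real.log_inv]
    have := Real.log_le_sub_one_of_pos hpos
    linarith
  have key : ∀ κ : ℝ, 0 ≤ 1 - u → κ * x + Real.exp (-κ) - Real.log 2 + r * Real.log (1 + qf (y / (1 - y)) k (1 - 2 * x)) ≤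
      κ * x + Real.exp (-κ) - y / 2 - 3 * y * ε / 8 - (Real.log 2 - 2 * y) * (1 - u) := by
    intro κ hu1
    have h3 : r * Real.log (1 + qf (y / (1 - y)) k (1 - 2 * x)) ≤ r * (-Real.log (1 - y) - y * (1 - u) / (1 - y)) := by
      gcongr
    have h4 : y * (1 - u) ≤ y * (1 - u) / (1 - y) := by
      rw [le_div_iff₀ (by linarith)]
      have : 0 ≤ y * (1 - u) * y := by positivity
      nlinarith
    have h5 : r * (y * (1 - u)) ≤ r * (y * (1 - u) / (1 - y)) := by gcongr
    have h6 : (Real.log 2 - 2 * y) * (1 - u) ≤ r * y * (1 - u) := by gcongr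
    nlinarith
  have hye : 0 < y * ε := by positivity
  have hl2y : 0.69 ≤ Real.log 2 - 2 * y := by linarith
  rcases le_or_gt (k * x) 1 with hc | hc
  · have hkx : 0 ≤ k * x := by positivity
    rcases le_or_gt ((k:ℝ) ^ 3 * x) 1 with hd | hd
    · -- region A
      have hp := pow_lower2 h0 (by linarith) k
      have hkk : (k:ℝ) ^ 2 * x ≤ 1 / k := by
        rw [le_div_iff₀ (by linarith)]; nlinarith
      have hx3 : x ≤ 1 / (1000 * k) := by
        rw [le_div_iff₀ (by positivity)]
        have : (1000 * 1000) * (k * x) ≤ (k:ℝ) ^ 2 * (k * x) := by gcongr; nlinarith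
        nlinarith
      have hx2 : x ^ 2 ≤ x * (1 / (1000 * k)) := by rw [sq]; gcongr
      have hsq : (k * x) ^ 2 / 2 ≤ x * (1 / k) / 2 := by
        have : (k * x) ^ 2 = x * ((k:ℝ) ^ 2 * x) := by ring
        rw [this]; gcongr
      have e1000 : (1:ℝ) / (1000 * k) = 1 / k / 1000 := by field_simp
      rw [e1000] at hx2
      have hik : 0 < (1:ℝ) / k := by positivity
      have hik1 : (1:ℝ) / k ≤ 1 / 1000 := by gcongr
      have hmain : 1 - u ≥ x * (k - 0.51 * (1 / k)) := by rw [hu]; nlinarith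
      refine ⟨k * Real.log 2 - 1 / k, (key _ ?_).trans ?_⟩
      · refine le_trans ?_ hmain
        exact mul_nonneg h0 (by linarith)
      · have hex : Real.exp (-(k * Real.log 2 - 1 / k)) ≤ y / 2 * (1 + ε / 8) := by
          rw [neg_sub, Real.exp_sub, mul_comm (k:ℝ), Real.exp_mul, Real.exp_log (by norm_num), Real.rpow_natCast]
          have e2 : (2:ℝ) ^ k = 2 / y := by rw [eq_div_iff hy.ne', mul_comm]; exact g.hy2
          rw [e2, div_div_eq_mul_div, mul_comm, mul_div_right_comm]
          refine mul_le_mul_of_nonneg_left ?_ (by positivity)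
          have hb : Real.exp (1 / k) ≤ 1 / (1 - 1 / k) := by
            have := Real.add_one_le_exp (-(1 / k : ℝ))
            rw [Real.exp_neg] at this
            rw [le_one_div (Real.exp_pos _) (by linarith), one_div (Real.exp _)]
            linarith
          refine hb.trans ?_
          rw [div_le_iff₀ (by linarith)]
          have : (1:ℝ) / k ≤ ε / 16 := by
            rw [div_le_iff₀ (by linarith)]; have := g.hke; linarith
          nlinarith
        have hyk' : y * k ≤ 0.01 * (1 / k) := by
          rw [mul_one_div, le_div_iff₀ (by linarith)]
          nlinarith
        have h7 : (Real.log 2 - 2 * y) * (x * (k - 0.51 * (1 / k))) ≤ (Real.log 2 - 2 * y) * (1 - u) := by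
          gcongr
        have h8 : (k * Real.log 2 - 1 / k) * x ≤ (Real.log 2 - 2 * y) * (x * (k - 0.51 * (1 / k))) := by
          have : (Real.log 2 - 2 * y) * (x * (k - 0.51 * (1 / k))) - (k * Real.log 2 - 1 / k) * x =
            x * ((1 / k) * (1 - 0.51 * Real.log 2 + 1.02 * y) - 2 * (y * k)) := by ring
          have h9 : 0 ≤ x * ((1 / k) * (1 - 0.51 * Real.log 2 + 1.02 * y) - 2 * (y * k)) := by
            refine mul_nonneg h0 ?_
            nlinarith
          linarith
        linarith
    · -- region B
      have hp := (pow_le_exp_neg (x := x) (by linarith) k).trans (exp_neg_chord hkx hc)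
      have hx1 : x ^ 2 ≤ 0.01 * (k * x) := by nlinarith
      have hmain : 1 - u ≥ 0.59 * (k * x) := by rw [hu]; linarith
      refine ⟨0.3 * k, (key _ (by linarith)).trans ?_⟩
      have h7 : 0.69 * (0.59 * (k * x)) ≤ (Real.log 2 - 2 * y) * (1 - u) :=
        mul_le_mul hl2y hmain (by positivity) (by linarith)
      have hex : Real.exp (-(0.3 * k)) ≤ 0.05 / k ^ 2 := by
        rw [Real.exp_neg, inv_le_comm₀ (Real.exp_pos _) (by positivity), inv_div]
        have := Real.pow_div_factorial_le_exp (0.3 * k) (by positivity) 4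
        refine le_trans ?_ this
        rw [div_le_div_iff₀ (by norm_num) (by positivity)]
        norm_num [Nat.factorial]
        have : (1000:ℝ) * 1000 * k ^ 2 ≤ k * k * k ^ 2 := by gcongr
        nlinarith
      have hkx2 : 1 / (k:ℝ) ^ 2 ≤ k * x := by
        rw [div_le_iff₀ (by positivity)]; nlinarith
      have e5 : (0.05:ℝ) / k ^ 2 = 0.05 * (1 / k ^ 2) := by ring
      have : 0 < y * ε := by positivity
      nlinarith
  · -- region C
    have hp := (pow_le_exp_neg (x := x) (by linarith) k)
    have hp1 : Real.exp (-(k * x)) ≤ Real.exp (-1) := Real.exp_le_exp.2 (by linarith)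
    have h2 : Real.exp (-1) ≤ 0.37 := by
      rw [Real.exp_neg, inv_le_comm₀ (Real.exp_pos _) (by norm_num)]
      have := Real.exp_one_gt_d9
      norm_num; linarith
    have h3 : Real.exp (-3) ≤ 0.06 := by
      have : Real.exp (-3) = Real.exp (-1) ^ 3 := by rw [← Real.exp_nat_mul]; norm_num
      rw [this]
      calc Real.exp (-1) ^ 3 ≤ 0.37 ^ 3 := by gcongr
        _ ≤ _ := by norm_num
    have hx2 : x ^ 2 ≤ 0.0025 := by nlinarith
    have hmain : 1 - u ≥ 0.6 := by rw [hu]; linarith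
    refine ⟨3, (key _ (by linarith)).trans ?_⟩
    have h7 : 0.69 * 0.6 ≤ (Real.log 2 - 2 * y) * (1 - u) :=
      mul_le_mul hl2y hmain (by positivity) (by linarith)
    nlinarith


lemma qf_nonneg (a : ℝ) (k : ℕ) (R : ℝ) : 0 ≤ qf a k R := by
  unfold qf
  rw [← sum_EV]
  refine mul_nonneg (sq_nonneg a) (Finset.sum_nonneg fun A hA => ?_)
  simp only [EV, Finset.mem_filter, Finset.mem_univ, true_and] at hA
  exact hA.2.pow_nonneg R

lemma qf_even (a : ℝ) (k : ℕ) (R : ℝ) : qf a k (-R) = qf a k R := by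
  unfold qf
  rw [sub_neg_eq_add, ← sub_eq_add_neg, add_comm ((1 - R) ^ k)]

lemma qf_sub (a : ℝ) (k : ℕ) (R : ℝ) : qf a k R - a ^ 2 * (k.choose 2) * R ^ 2 =
    a ^ 2 * ∑ A ∈ EV k \ PR k, R ^ A.card := by
  unfold qf
  rw [← sum_EV, ← card_PR, mul_assoc, ← sum_PR, ← mul_sub, Finset.sum_sdiff_eq_sub (PR_sub k)]

lemma sdiff_card {k : ℕ} {A : Finset (Fin k)} (hA : A ∈ EV k \ PR k) : Even A.card ∧ 4 ≤ A.card := by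
  simp only [EV, PR, Finset.mem_sdiff, Finset.mem_filter, Finset.mem_univ, true_and] at hA
  obtain ⟨⟨h1, h2⟩, h3⟩ := hA
  have := Finset.card_pos.2 h1
  obtain ⟨c, hc⟩ := h2
  exact ⟨⟨c, hc⟩, by omega⟩

lemma qf_ge (a : ℝ) (k : ℕ) (R : ℝ) : a ^ 2 * (k.choose 2) * R ^ 2 ≤ qf a k R := by
  have h := qf_sub a k R
  have : 0 ≤ a ^ 2 * ∑ A ∈ EV k \ PR k, R ^ A.card :=
    mul_nonneg (sq_nonneg a) (Finset.sum_nonneg fun A hA => (sdiff_card hA).1.pow_nonneg R)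
  linarith

lemma qf_sub_le (a : ℝ) (k : ℕ) (R : ℝ) (hR : |R| ≤ 1) :
    qf a k R - a ^ 2 * (k.choose 2) * R ^ 2 ≤ a ^ 2 * 2 ^ k * R ^ 4 := by
  rw [qf_sub, mul_assoc]
  refine mul_le_mul_of_nonneg_left ?_ (sq_nonneg a)
  have hR4 : R ^ 4 = |R| ^ 4 := (Even.pow_abs (by decide) R).symm
  calc ∑ A ∈ EV k \ PR k, R ^ A.card ≤ ∑ A ∈ EV k \ PR k, R ^ 4 := by
        refine Finset.sum_le_sum fun A hA => ?_
        obtain ⟨h1, h2⟩ := sdiff_card hA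
        rw [← h1.pow_abs, hR4]
        exact pow_le_pow_of_le_one (abs_nonneg _) hR h2
    _ ≤ ∑ A : Finset (Fin k), R ^ 4 :=
        Finset.sum_le_sum_of_subset_of_nonneg (Finset.subset_univ _) fun _ _ _ => by
          rw [hR4]; positivity
    _ = 2 ^ k * R ^ 4 := by simp

lemma qf_near (a : ℝ) (k : ℕ) (R : ℝ) (hR : |R| ≤ 0.9) :
    qf a k R ≤ a ^ 2 * (R ^ 2 * (1.9 ^ k / 0.81)) := by
  unfold qf
  refine mul_le_mul_of_nonneg_left ?_ (sq_nonneg a)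
  rw [← sum_EV]
  calc ∑ A ∈ EV k, R ^ A.card ≤ ∑ A ∈ EV k, R ^ 2 / 0.81 * (0.9:ℝ) ^ A.card := by
        refine Finset.sum_le_sum fun A hA => ?_
        simp only [EV, Finset.mem_filter, Finset.mem_univ, true_and] at hA
        obtain ⟨h1, h2⟩ := hA
        have := Finset.card_pos.2 h1
        obtain ⟨c, hc⟩ : ∃ c, A.card = 2 + c := ⟨A.card - 2, by obtain ⟨d, hd⟩ := h2; omega⟩
        rw [← h2.pow_abs, hc, pow_add, pow_add, sq_abs]
        have h3 : |R| ^ c ≤ 0.9 ^ c := pow_le_pow_left₀ (abs_nonneg _) hR c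
        have : R ^ 2 / 0.81 * (0.9 ^ 2 * 0.9 ^ c) = R ^ 2 * 0.9 ^ c := by
          rw [show (0.81:ℝ) = 0.9 ^ 2 by norm_num]; field_simp
        rw [this]
        exact mul_le_mul_of_nonneg_left h3 (sq_nonneg R)
    _ ≤ ∑ A : Finset (Fin k), R ^ 2 / 0.81 * (0.9:ℝ) ^ A.card :=
        Finset.sum_le_sum_of_subset_of_nonneg (Finset.subset_univ _) fun _ _ _ => by positivity
    _ = _ := by
        rw [← Finset.mul_sum, sum_all]; norm_num; ring

lemma Good.ra2 (g : Good ε k y r) : r * (y / (1 - y)) ^ 2 ≤ y := by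
  have hy := g.hy
  have h1 := g.ry_upper
  have h2 := g.ysmall0
  have h3 := g.he1
  have h4 := g.r_pos
  have h5 : y / (1 - y) ≤ 1.1 * y := by
    rw [div_le_iff₀ (by linarith)]; nlinarith
  have h6 : 0 ≤ y / (1 - y) := div_nonneg hy.le (by linarith)
  calc r * (y / (1 - y)) ^ 2 ≤ r * (1.1 * y) ^ 2 := by gcongr
    _ = 1.21 * y * (r * y) := by ring
    _ ≤ 1.21 * y * 0.7 := by gcongr
    _ ≤ y := by linarith

lemma Good.near (g : Good ε k y r) (R : ℝ) (hR : |R| ≤ 0.9) :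
    r * qf (y / (1 - y)) k R ≤ R ^ 2 / 8 := by
  have hy := g.hy
  have h1 := qf_near (y / (1 - y)) k R hR
  have e2 : y * (1.9:ℝ) ^ k = 2 * 0.95 ^ k := by
    rw [show (1.9:ℝ) = 0.95 * 2 by norm_num, mul_pow, mul_left_comm, g.hy2]; ring
  calc r * qf (y / (1 - y)) k R ≤ r * ((y / (1 - y)) ^ 2 * (R ^ 2 * (1.9 ^ k / 0.81))) :=
        mul_le_mul_of_nonneg_left h1 g.r_pos.le
    _ = (r * (y / (1 - y)) ^ 2) * (R ^ 2 * (1.9 ^ k / 0.81)) := by ring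
    _ ≤ y * (R ^ 2 * (1.9 ^ k / 0.81)) := by gcongr; exact g.ra2
    _ = R ^ 2 * ((y * 1.9 ^ k) / 0.81) := by ring
    _ ≤ R ^ 2 / 8 := by
        rw [e2, div_eq_mul_inv (R ^ 2) 8]
        refine mul_le_mul_of_nonneg_left ?_ (sq_nonneg R)
        have := g.h95
        rw [div_le_iff₀ (by norm_num)]
        norm_num at this ⊢; linarith

lemma Good.rb (g : Good ε k y r) : r * ((y / (1 - y)) ^ 2 * (k.choose 2)) ≤ 1 / 8 := by
  have hy := g.hy
  have h1 := g.ra2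
  have h2 := g.ysmall2
  have h3 := g.he1
  have h4 : ((k.choose 2 : ℕ) : ℝ) ≤ k ^ 2 := by exact_mod_cast Nat.choose_le_pow k 2
  calc r * ((y / (1 - y)) ^ 2 * (k.choose 2)) = (r * (y / (1 - y)) ^ 2) * (k.choose 2) := by ring
    _ ≤ y * k ^ 2 := by gcongr
    _ ≤ 1 / 8 := by linarith

lemma Good.ak (g : Good ε k y r) : 0 ≤ y / (1 - y) ∧ y / (1 - y) * (k.choose 2) ≤ 1 / 2 := by
  have hy := g.hy
  have h2 := g.ysmall2
  have h3 := g.he1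
  have h0 := g.ysmall0
  have h6 : 0 ≤ y / (1 - y) := div_nonneg hy.le (by linarith)
  have h5 : y / (1 - y) ≤ 1.1 * y := by
    rw [div_le_iff₀ (by linarith)]; nlinarith
  have h4 : ((k.choose 2 : ℕ) : ℝ) ≤ k ^ 2 := by exact_mod_cast Nat.choose_le_pow k 2
  refine ⟨h6, ?_⟩
  calc y / (1 - y) * (k.choose 2) ≤ (1.1 * y) * k ^ 2 := by gcongr
    _ ≤ 1 / 2 := by linarith

lemma Good.a_eq (g : Good ε k y r) : y / (1 - y) * ((2:ℝ) ^ (k - 1) - 1) = 1 := by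
  have hy := g.hy
  have h3 := g.he1
  have h0 := g.ysmall0
  have e2 : (2:ℝ) ^ k = 2 * 2 ^ (k - 1) := by
    rw [← pow_succ', Nat.sub_add_cancel (by have := g.hk; omega)]
  have h := g.hy2
  rw [e2] at h
  have : (1 - y) ≠ 0 := by linarith
  rw [div_mul_eq_mul_div, div_eq_one_iff_eq this]
  linarith

end Numerics
end HG

namespace HG

section Moment

variable {ε y r : ℝ} {k : ℕ}

lemma pow_sub_le {A B : ℝ} (hB : 1 ≤ B) (hAB : B ≤ A) (m : ℕ) : A ^ m - B ^ m ≤ m * (A - B) * A ^ m := by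
  induction m with
  | zero => simp
  | succ m ih =>
    have hA : 0 ≤ A ^ m := pow_nonneg (by linarith) m
    have h1 : A ^ m ≤ A ^ (m + 1) := pow_le_pow_right₀ (by linarith) (by omega)
    have h2 : B ^ m ≤ A ^ m := pow_le_pow_left₀ (by linarith) hAB m
    have h3 : A * (A ^ m - B ^ m) ≤ A * (m * (A - B) * A ^ m) := mul_le_mul_of_nonneg_left ih (by linarith)
    have h4 : (A - B) * B ^ m ≤ (A - B) * A ^ (m + 1) := mul_le_mul_of_nonneg_left (h2.trans h1) (by linarith)
    push_cast
    rw [pow_succ] at *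
    rw [pow_succ B]
    nlinarith

lemma one_add_pow_le {z : ℝ} (hz : 0 ≤ z) (m : ℕ) : (1 + z) ^ m ≤ Real.exp (m * z) := by
  rw [Real.exp_nat_mul]
  refine pow_le_pow_left₀ (by linarith) ?_ m
  have := Real.add_one_le_exp z; linarith

lemma Good.near_term (g : Good ε k y r) (L j m : ℕ) (hL : 2 ≤ L) (hj : j ≤ 2 * L)
    (hm : (m:ℝ) ≤ r * (4 * L)) (R : ℝ) (hR : R = ((j:ℝ) - L) / L) (hR9 : |R| ≤ 0.9) :
    pw L j * ((1 + qf (y / (1 - y)) k R) ^ m - (1 + (y / (1 - y)) ^ 2 * (k.choose 2) * R ^ 2) ^ m) ≤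
      128 / (L * Real.sqrt L) * Real.exp (-(1 / 2 * L * R ^ 2)) := by
  set a := y / (1 - y) with ha
  have hL0 : (2:ℝ) ≤ L := by exact_mod_cast hL
  have hLp : (0:ℝ) < L := by linarith
  have hsp : 0 < Real.sqrt L := Real.sqrt_pos.2 hLp
  have hr := g.r_pos
  have hm0 : (0:ℝ) ≤ m := Nat.cast_nonneg m
  have hp := pw_le L j hL hj
  rw [← hR] at hp
  have hq0 := qf_nonneg a k R
  have h1 := pow_sub_le (A := 1 + qf a k R) (B := 1 + a ^ 2 * (k.choose 2) * R ^ 2)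
    (by have : 0 ≤ a ^ 2 * (k.choose 2) * R ^ 2 := by positivity
        linarith) (by have := qf_ge a k R; linarith) m
  have h2 := qf_sub_le a k R (by linarith)
  have h3 : (1 + qf a k R) ^ m ≤ Real.exp (1 / 2 * L * R ^ 2) := by
    refine (one_add_pow_le hq0 m).trans (Real.exp_le_exp.2 ?_)
    have := g.near R hR9
    rw [← ha] at this
    calc (m:ℝ) * qf a k R ≤ (r * (4 * L)) * qf a k R := by gcongr
      _ = 4 * L * (r * qf a k R) := by ring
      _ ≤ 4 * L * (R ^ 2 / 8) := by gcongr
      _ = _ := by ring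
  have hR4 : 0 ≤ R ^ 4 := by positivity
  have hra : r * (a ^ 2 * 2 ^ k) ≤ 2 := by
    have := g.ra2
    rw [← ha] at this
    have h2 := g.hy2
    have h2k : (0:ℝ) < 2 ^ k := by positivity
    calc r * (a ^ 2 * 2 ^ k) = (r * a ^ 2) * 2 ^ k := by ring
      _ ≤ y * 2 ^ k := by gcongr
      _ = 2 := h2
  have h4 : R ^ 4 * Real.exp (-(1 / 2 * L * R ^ 2)) ≤ 8 / L ^ 2 := by
    have := Real.pow_div_factorial_le_exp (1 / 2 * L * R ^ 2) (by positivity) 2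
    rw [Real.exp_neg, ← div_eq_mul_inv, div_le_div_iff₀ (Real.exp_pos _) (by positivity)]
    norm_num [Nat.factorial] at this
    nlinarith
  have h5 : (1 + qf a k R) ^ m - (1 + a ^ 2 * (k.choose 2) * R ^ 2) ^ m ≤
      8 * L * R ^ 4 * Real.exp (1 / 2 * L * R ^ 2) := by
    refine h1.trans ?_
    rw [show 1 + qf a k R - (1 + a ^ 2 * (k.choose 2) * R ^ 2) = qf a k R - a ^ 2 * (k.choose 2) * R ^ 2 by ring]
    have h6 : (m:ℝ) * (qf a k R - a ^ 2 * (k.choose 2) * R ^ 2) ≤ 8 * L * R ^ 4 := by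
      calc (m:ℝ) * (qf a k R - a ^ 2 * (k.choose 2) * R ^ 2) ≤ m * (a ^ 2 * 2 ^ k * R ^ 4) := by gcongr
        _ ≤ (r * (4 * L)) * (a ^ 2 * 2 ^ k * R ^ 4) := by gcongr
        _ = (r * (a ^ 2 * 2 ^ k)) * (4 * L * R ^ 4) := by ring
        _ ≤ 2 * (4 * L * R ^ 4) := by gcongr
        _ = _ := by ring
    refine mul_le_mul h6 h3 (by positivity) (by positivity)
  have hE := Real.exp_pos (-(1 / 2 * L * R ^ 2))
  calc _ ≤ pw L j * (8 * L * R ^ 4 * Real.exp (1 / 2 * L * R ^ 2)) :=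
        mul_le_mul_of_nonneg_left h5 (pw_nonneg _ _)
    _ ≤ (2 / Real.sqrt L * Real.exp (-(3 / 2 * L * R ^ 2))) * (8 * L * R ^ 4 * Real.exp (1 / 2 * L * R ^ 2)) := by
        gcongr
    _ = 16 * L / Real.sqrt L * (R ^ 4 * Real.exp (-(1 / 2 * L * R ^ 2))) * Real.exp (-(1 / 2 * L * R ^ 2)) := by
        have : Real.exp (-(3 / 2 * L * R ^ 2)) = Real.exp (-(1 / 2 * L * R ^ 2)) *
          Real.exp (-(1 / 2 * L * R ^ 2)) * Real.exp (-(1 / 2 * L * R ^ 2)) := by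
          rw [← Real.exp_add, ← Real.exp_add]; congr 1; ring
        have e1 : Real.exp (-(1 / 2 * L * R ^ 2)) * Real.exp (1 / 2 * L * R ^ 2) = 1 := by
          rw [← Real.exp_add]; simp
        rw [this]
        linear_combination (16 * L / Real.sqrt L * (R ^ 4 * Real.exp (-(1 / 2 * L * R ^ 2))) * Real.exp (-(1 / 2 * L * R ^ 2))) * e1
    _ ≤ 16 * L / Real.sqrt L * (8 / L ^ 2) * Real.exp (-(1 / 2 * L * R ^ 2)) := by gcongr
    _ = _ := by
        congr 1
        field_simp; norm_num

lemma Good.far_aux (g : Good ε k y r) (L j m : ℕ) (hL : 2 ≤ L)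
    (hm : (m:ℝ) ≤ r * (4 * L)) (x : ℝ) (h0 : 0 ≤ x) (h1 : x ≤ 0.05) (hx : (j:ℝ) = 2 * L * x) :
    pw L j * (1 + qf (y / (1 - y)) k (1 - 2 * x)) ^ m ≤ Real.sqrt (8 * L) * Real.exp (-(L * (y * ε / 2))) := by
  obtain ⟨κ, hκ⟩ := g.far x h0 h1
  have hp := pw_far L j (by omega) κ x hx
  have hq := qf_nonneg (y / (1 - y)) k (1 - 2 * x)
  set Q := 1 + qf (y / (1 - y)) k (1 - 2 * x) with hQ
  have hQ1 : 1 ≤ Q := by linarith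
  have hl : 0 ≤ Real.log Q := Real.log_nonneg hQ1
  have h2 : Q ^ m ≤ Real.exp (4 * L * (r * Real.log Q)) := by
    rw [← Real.exp_log (show 0 < Q by linarith), ← Real.exp_nat_mul, Real.log_exp]
    apply Real.exp_le_exp.2
    calc (m:ℝ) * Real.log Q ≤ (r * (4 * L)) * Real.log Q := by gcongr
      _ = _ := by ring
  calc pw L j * Q ^ m ≤ (Real.sqrt (8 * L) * Real.exp (4 * L * (κ * x + Real.exp (-κ) - Real.log 2))) *
        Real.exp (4 * L * (r * Real.log Q)) := by
        refine mul_le_mul hp h2 (by positivity) (by positivity)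
    _ = Real.sqrt (8 * L) * Real.exp (4 * L * (κ * x + Real.exp (-κ) - Real.log 2 + r * Real.log Q)) := by
        rw [mul_assoc, ← Real.exp_add]; congr 2; ring
    _ ≤ _ := by
        refine mul_le_mul_of_nonneg_left (Real.exp_le_exp.2 ?_) (Real.sqrt_nonneg _)
        have hL0 : (0:ℝ) ≤ L := by positivity
        nlinarith

lemma Good.far_term (g : Good ε k y r) (L j m : ℕ) (hL : 2 ≤ L) (hj : j ≤ 2 * L)
    (hm : (m:ℝ) ≤ r * (4 * L)) (R : ℝ) (hR : R = ((j:ℝ) - L) / L) (hR9 : 0.9 < |R|) :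
    pw L j * ((1 + qf (y / (1 - y)) k R) ^ m - (1 + (y / (1 - y)) ^ 2 * (k.choose 2) * R ^ 2) ^ m) ≤
      Real.sqrt (8 * L) * Real.exp (-(L * (y * ε / 2))) := by
  have hL0 : (2:ℝ) ≤ L := by exact_mod_cast hL
  have hLp : (0:ℝ) < L := by linarith
  have hb : 0 ≤ (1 + (y / (1 - y)) ^ 2 * (k.choose 2) * R ^ 2) ^ m := by positivity
  refine le_trans (mul_le_mul_of_nonneg_left (sub_le_self _ hb) (pw_nonneg _ _)) ?_
  have hRL : R * L = j - L := by rw [hR]; field_simp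
  have hj' : (j:ℝ) ≤ 2 * L := by exact_mod_cast hj
  rcases lt_abs.1 hR9 with h | h
  · rw [← pw_symm L j hj]
    have e : R = 1 - 2 * ((1 - R) / 2) := by ring
    rw [e]
    refine g.far_aux L _ m hL hm _ ?_ (by linarith) ?_
    · have : R ≤ 1 := by
        rw [hR, div_le_one hLp]; linarith
      linarith
    · rw [Nat.cast_sub hj]; push_cast; linarith
  · rw [← qf_even]
    have e : -R = 1 - 2 * ((1 + R) / 2) := by ring
    rw [e]
    refine g.far_aux L _ m hL hm _ ?_ (by linarith) ?_
    · have : -1 ≤ R := by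
        rw [hR, le_div_iff₀ hLp]; have : (0:ℝ) ≤ j := Nat.cast_nonneg j
        linarith
      linarith
    · linarith

/-- the second-moment error -/
noncomputable def Derr (c : ℝ) (L : ℕ) : ℝ := 1024 / L + 24 * ((L:ℝ) ^ 2 * Real.exp (-c) ^ L)

lemma Derr_tendsto (c : ℝ) (hc : 0 < c) : Tendsto (Derr c) atTop (nhds 0) := by
  have h1 : Tendsto (fun L : ℕ => (1024:ℝ) / L) atTop (nhds 0) := tendsto_const_div_atTop_nhds_zero_nat _
  have h2 := tendsto_pow_const_mul_const_pow_of_lt_one 2 (r := Real.exp (-c)) (Real.exp_pos _).le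
    (by rw [Real.exp_lt_one_iff]; linarith)
  have := h1.add (h2.const_mul 24)
  simp only [mul_zero, add_zero] at this
  exact this

lemma Good.D_sum (g : Good ε k y r) (L m : ℕ) (hL : 2 ≤ L) (hm : (m:ℝ) ≤ r * (4 * L)) :
    ∑ j ∈ Finset.range (2 * L + 1), pw L j * ((1 + qf (y / (1 - y)) k (((j:ℝ) - L) / L)) ^ m -
      (1 + (y / (1 - y)) ^ 2 * (k.choose 2) * (((j:ℝ) - L) / L) ^ 2) ^ m) ≤ Derr (y * ε / 2) L := by
  have hL0 : (2:ℝ) ≤ L := by exact_mod_cast hL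
  have hLp : (0:ℝ) < L := by linarith
  have hsp : 0 < Real.sqrt L := Real.sqrt_pos.2 hLp
  calc _ ≤ ∑ j ∈ Finset.range (2 * L + 1), (128 / (L * Real.sqrt L) * Real.exp (-(1 / 2 * L * (((j:ℝ) - L) / L) ^ 2)) +
        Real.sqrt (8 * L) * Real.exp (-(L * (y * ε / 2)))) := by
        refine Finset.sum_le_sum fun j hj => ?_
        have hj' : j ≤ 2 * L := by simp at hj; omega
        rcases le_or_gt |((j:ℝ) - L) / L| 0.9 with h | h
        · have := g.near_term L j m hL hj' hm _ rfl h
          have h2 : 0 ≤ Real.sqrt (8 * L) * Real.exp (-(L * (y * ε / 2))) := by positivity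
          linarith
        · have := g.far_term L j m hL hj' hm _ rfl h
          have h2 : 0 ≤ 128 / (L * Real.sqrt L) * Real.exp (-(1 / 2 * L * (((j:ℝ) - L) / L) ^ 2)) := by positivity
          linarith
    _ = 128 / (L * Real.sqrt L) * ∑ j ∈ Finset.range (2 * L + 1), Real.exp (-(1 / 2 * L * (((j:ℝ) - L) / L) ^ 2)) +
        (2 * L + 1) * (Real.sqrt (8 * L) * Real.exp (-(L * (y * ε / 2)))) := by
        rw [Finset.sum_add_distrib, ← Finset.mul_sum]; simp
    _ ≤ 128 / (L * Real.sqrt L) * (8 * Real.sqrt L) + (3 * L) * ((8 * L) * Real.exp (-(L * (y * ε / 2)))) := by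
        have h1 := gauss_sum L hL
        have h2 : Real.sqrt (8 * L) ≤ 8 * L := by
          rw [Real.sqrt_le_left (by positivity)]; nlinarith
        gcongr
        linarith
    _ = Derr (y * ε / 2) L := by
        unfold Derr
        rw [← Real.exp_nat_mul]
        congr 1
        · field_simp; norm_num
        · rw [mul_neg]; ring

lemma Good.K_sum (g : Good ε k y r) (L m : ℕ) (hL : 2 ≤ L) (hm : (m:ℝ) ≤ r * (4 * L)) :
    ∑ j ∈ Finset.range (2 * L + 1), pw L j * (
      (1 + (y / (1 - y)) ^ 2 * (k.choose 2) * (((j:ℝ) - L) / L) ^ 2) ^ m *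
        Real.exp (L / 2 * (((j:ℝ) - L) / L) ^ 2)) ≤ 16 := by
  refine le_trans (Finset.sum_le_sum fun j hj => ?_) (sum_R1 L hL)
  refine mul_le_mul_of_nonneg_left ?_ (pw_nonneg _ _)
  set R := ((j:ℝ) - L) / L
  set a := y / (1 - y) with ha
  have h1 := one_add_pow_le (z := a ^ 2 * (k.choose 2) * R ^ 2) (by positivity) m
  have h2 : (m:ℝ) * (a ^ 2 * (k.choose 2) * R ^ 2) ≤ L / 2 * R ^ 2 := by
    have := g.rb
    rw [← ha] at this
    calc (m:ℝ) * (a ^ 2 * (k.choose 2) * R ^ 2) ≤ (r * (4 * L)) * (a ^ 2 * (k.choose 2) * R ^ 2) := by gcongr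
      _ = (r * (a ^ 2 * (k.choose 2))) * (4 * L * R ^ 2) := by ring
      _ ≤ 1 / 8 * (4 * L * R ^ 2) := by gcongr
      _ = _ := by ring
  calc _ ≤ Real.exp (L / 2 * R ^ 2) * Real.exp (L / 2 * R ^ 2) := by
        gcongr
        exact h1.trans (Real.exp_le_exp.2 h2)
    _ = _ := by rw [← Real.exp_add]; congr 1; ring

open Classical in
lemma Good.tuple_bound (g : Good ε k y r) (δ : ℝ) (hδ : 0 < δ) : ∀ᶠ L : ℕ in atTop, ∀ m : ℕ,
    (m:ℝ) ≤ r * (4 * L) →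
    𝔼 e : Fin m → Fin k → Fin (4 * L), (if TC e then (0:ℝ) else 1) ≤ δ := by
  set C := 1 + 16 * Real.exp 4 / 2 with hC
  have hCp : 0 < C := by positivity
  set θ := Real.exp (-(2 * C / δ)) with hθ
  have hθp : 0 < θ := Real.exp_pos _
  have hc : 0 < y * ε / 2 := by have := g.hy; have := g.he; positivity
  have hev : ∀ᶠ L : ℕ in atTop, Derr (y * ε / 2) L < θ ^ 2 * (δ / 2) :=
    (Derr_tendsto _ hc).eventually_lt_const (by positivity)
  filter_upwards [hev, eventually_ge_atTop 2] with L hD hL m hm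
  have hL1 : 0 < L := by omega
  have hL0 : (2:ℝ) ≤ L := by exact_mod_cast hL
  have hLp : (0:ℝ) < L := by linarith
  have : Nonempty (Fin (4 * L)) := ⟨⟨0, by omega⟩⟩
  set a := y / (1 - y) with ha
  obtain ⟨ha0, hak⟩ := g.ak
  rw [← ha] at ha0 hak
  have key := prob_zero_bound (T := Fin k → Fin (4 * L)) (Ω := Om L) (xw a) (et a) (abs_et a ha0 hak)
    (expect_et hL1 a) (fun S S' => ov S S' ^ 2) (fun S S' => qf a k (ov S S')) (fun _ _ => sq_nonneg _)
    (a ^ 2 * (k.choose 2)) (L / 2) 16 (by positivity) (by positivity)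
    (fun S S' => expect_et_et hL1 a S S') (fun S S' => expect_xw_xw hL1 a S S')
    (fun S S' => expect_xw_et hL1 a S S') m ?_ (Derr (y * ε / 2) L) ?_ θ hθp (Real.exp_lt_one_iff.2 (by
      have : 0 < 2 * C / δ := by positivity
      linarith))
  · have h1 : 𝔼 e : Fin m → Fin k → Fin (4 * L), (if TC e then (0:ℝ) else 1) ≤
        𝔼 e : Fin m → Fin k → Fin (4 * L), (if PF (xw (k := k) (L := L) a) e = 0 then (1:ℝ) else 0) := by
      refine Finset.expect_le_expect fun e _ => ?_
      by_cases h : PF (xw (k := k) (L := L) a) e = 0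
      · rw [if_pos h]; split_ifs <;> norm_num
      · rw [if_pos (TC_of_PF (by have := g.hk; omega) a g.a_eq e h), if_neg h]
    refine h1.trans (key.trans ?_)
    have h2 : Derr (y * ε / 2) L / θ ^ 2 ≤ δ / 2 := by
      rw [div_le_iff₀ (by positivity)]; linarith
    have h3 : Real.log (1 / θ) = 2 * C / δ := by
      rw [one_div, Real.log_inv, hθ, Real.log_exp, neg_neg]
    have h4 : (1 + 4 * (a ^ 2 * (k.choose 2)) / (L / 2)) ^ m ≤ Real.exp 4 := by
      refine (one_add_pow_le (by positivity) m).trans (Real.exp_le_exp.2 ?_)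
      have := g.rb
      rw [← ha] at this
      calc (m:ℝ) * (4 * (a ^ 2 * (k.choose 2)) / (L / 2)) ≤ (r * (4 * L)) * (4 * (a ^ 2 * (k.choose 2)) / (L / 2)) := by gcongr
        _ = 32 * (r * (a ^ 2 * (k.choose 2))) := by field_simp; ring
        _ ≤ 4 := by linarith
    have h5 : (1 + 16 * (1 + 4 * (a ^ 2 * (k.choose 2)) / (L / 2)) ^ m / 2) / Real.log (1 / θ) ≤ δ / 2 := by
      rw [h3, div_le_iff₀ (by positivity)]
      have : δ / 2 * (2 * C / δ) = C := by field_simp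
      rw [this, hC]
      linarith
    linarith
  · refine Finset.expect_le Finset.univ_nonempty fun S _ => ?_
    refine (expect_ov_le hL1 S (fun R => (1 + a ^ 2 * (k.choose 2) * R ^ 2) ^ m * Real.exp (L / 2 * R ^ 2))
      (fun j _ => by positivity)).trans ?_
    exact g.K_sum L m hL hm
  · refine Finset.expect_le Finset.univ_nonempty fun S _ => ?_
    refine (expect_ov_le hL1 S (fun R => (1 + qf a k R) ^ m - (1 + a ^ 2 * (k.choose 2) * R ^ 2) ^ m)
      (fun j _ => ?_)).trans ?_
    · rw [sub_nonneg]
      refine pow_le_pow_left₀ (by positivity) ?_ m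
      have := qf_ge a k (((j:ℝ) - L) / L); linarith
    · exact g.D_sum L m hL hm

end Moment
end HG

namespace HG

section Reduction

lemma expect_fin_succ' {T : Type*} [Fintype T] [Nonempty T] (m : ℕ) (F : (Fin (m + 1) → T) → ℝ) :
    𝔼 e : Fin (m + 1) → T, F e = 𝔼 t : T, 𝔼 e : Fin m → T, F (Fin.cons t e) := by
  rw [expect_fin_succ, Finset.expect_comm]

open Classical in
/-- abstract coupling between tuples and sets -/
lemma couple {T Q Col : Type*} [Fintype T] [Fintype Q] [Nonempty T] [Nonempty Q]
    (φ : T → Option Q) (ok : Q → Set Col) (M : ℕ)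
    (hM : ∀ s, (Finset.univ.filter fun t => φ t = some s).card = M) (m' : ℕ) :
    ∀ (m : ℕ) (W : Set Col),
    𝔼 e : Fin m' → T, (if (∃ c ∈ W, ∀ i s, φ (e i) = some s → c ∈ ok s) ∧
        m ≤ (Finset.univ.filter fun i => φ (e i) ≠ none).card then (1:ℝ) else 0) ≤
      𝔼 E : Fin m → Q, (if ∃ c ∈ W, ∀ i, c ∈ ok (E i) then (1:ℝ) else 0) := by
  induction m' with
  | zero =>
    intro m W
    rcases m with _ | m
    · simp [Finset.expect]
    · simp
      exact Finset.expect_nonneg fun E _ => by split_ifs <;> norm_num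
  | succ m' ih =>
    intro m W
    rcases m with _ | j
    · have h1 : 𝔼 E : Fin 0 → Q, (if ∃ c ∈ W, ∀ i, c ∈ ok (E i) then (1:ℝ) else 0) =
          if ∃ c, c ∈ W then 1 else 0 := by simp [Finset.expect]
      rw [h1]
      refine Finset.expect_le Finset.univ_nonempty fun e _ => ?_
      by_cases h : ∃ c, c ∈ W
      · rw [if_pos h]; split_ifs <;> norm_num
      · rw [if_neg h, if_neg]
        rintro ⟨⟨c, hc, -⟩, -⟩
        exact h ⟨c, hc⟩
    · set P : ℝ := 𝔼 E : Fin (j + 1) → Q, (if ∃ c ∈ W, ∀ i, c ∈ ok (E i) then (1:ℝ) else 0) with hP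
      set P' : Q → ℝ := fun s => 𝔼 E : Fin j → Q, (if ∃ c ∈ W ∩ ok s, ∀ i, c ∈ ok (E i) then (1:ℝ) else 0) with hP'
      have hPP : P = 𝔼 s, P' s := by
        rw [hP, expect_fin_succ']
        refine Finset.expect_congr rfl fun s _ => Finset.expect_congr rfl fun E _ => ?_
        congr 1
        simp only [Fin.forall_fin_succ, Fin.cons_zero, Fin.cons_succ, Set.mem_inter_iff, and_assoc]
      rw [expect_fin_succ']
      have hstep : ∀ t : T, 𝔼 e : Fin m' → T, (if (∃ c ∈ W, ∀ i s, φ ((Fin.cons t e : Fin (m' + 1) → T) i) = some s → c ∈ ok s) ∧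
        j + 1 ≤ (Finset.univ.filter fun i => φ ((Fin.cons t e : Fin (m' + 1) → T) i) ≠ none).card then (1:ℝ) else 0) ≤
          (φ t).elim P P' := by
        intro t
        have hcard : ∀ e : Fin m' → T, (Finset.univ.filter fun i => φ ((Fin.cons t e : Fin (m' + 1) → T) i) ≠ none).card =
            (Finset.univ.filter fun i => φ (e i) ≠ none).card + (if φ t ≠ none then 1 else 0) := by
          intro e
          simp only [Finset.card_filter, Fin.sum_univ_succ, Fin.cons_zero, Fin.cons_succ]
          rw [add_comm]
        rcases hφ : φ t with _ | s
        · refine le_trans (le_of_eq ?_) (ih (j + 1) W)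
          refine Finset.expect_congr rfl fun e _ => ?_
          rw [hcard]
          simp [Fin.forall_fin_succ, hφ]
        · refine le_trans (le_of_eq ?_) (ih j (W ∩ ok s))
          refine Finset.expect_congr rfl fun e _ => ?_
          rw [hcard]
          simp [Fin.forall_fin_succ, hφ, and_assoc]
      refine (Finset.expect_le_expect fun t _ => hstep t).trans (le_of_eq ?_)
      -- evaluate
      have hT : ((Fintype.card T : ℕ) : ℝ) ≠ 0 := by exact_mod_cast Fintype.card_ne_zero
      have hQ : ((Fintype.card Q : ℕ) : ℝ) ≠ 0 := by exact_mod_cast Fintype.card_ne_zero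
      have hgen : ∀ (A : ℝ) (B : Q → ℝ), ∑ t : T, (φ t).elim A B =
          (Finset.univ.filter fun t => φ t = none).card * A + M * ∑ s, B s := by
        intro A B
        rw [← Finset.sum_fiberwise (s := Finset.univ) (g := φ), Fintype.sum_option]
        congr 1
        · rw [Finset.sum_congr rfl (g := fun _ => A) (fun t ht => by
            rw [(Finset.mem_filter.1 ht).2]; rfl)]
          simp
        · rw [Finset.mul_sum]
          refine Finset.sum_congr rfl fun s _ => ?_
          rw [Finset.sum_congr rfl (g := fun _ => B s) (fun t ht => by
            rw [(Finset.mem_filter.1 ht).2]; rfl)]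
          simp [hM s]
      have hone := hgen 1 (fun _ => 1)
      have hone' : ∑ t : T, (φ t).elim (1:ℝ) (fun _ => 1) = Fintype.card T := by
        rw [Finset.sum_congr rfl (g := fun _ => (1:ℝ)) (fun t _ => by cases φ t <;> rfl)]
        simp
      rw [hone'] at hone
      simp at hone
      have hS : ∑ s, P' s = Fintype.card Q * P := by
        rw [hPP, Fintype.expect_eq_sum_div_card]; field_simp
      rw [Fintype.expect_eq_sum_div_card, hgen, hS, div_eq_iff hT, hone]
      ring


variable {k n N : ℕ}

/-- the tuple listing the set `s` in the order `σ` -/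
def tup (hn : n ≤ N) (s : {s : Finset (Fin n) // s.card = k}) (σ : Fin k ≃ s.1) : Fin k → Fin N :=
  fun i => Fin.castLE hn (σ i).1

lemma tup_set (hn : n ≤ N) (s : {s : Finset (Fin n) // s.card = k}) (σ : Fin k ≃ s.1) (v : Fin n) :
    v ∈ s.1 ↔ ∃ i, tup hn s σ i = Fin.castLE hn v := by
  constructor
  · intro h
    exact ⟨σ.symm ⟨v, h⟩, by simp [tup]⟩
  · rintro ⟨i, hi⟩
    have : (σ i).1 = v := Fin.castLE_injective hn hi
    rw [← this]; exact (σ i).2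

lemma tup_inj (hn : n ≤ N) (s s' : {s : Finset (Fin n) // s.card = k}) (σ : Fin k ≃ s.1) (σ' : Fin k ≃ s'.1)
    (h : tup hn s σ = tup hn s' σ') : s = s' := by
  apply Subtype.ext
  ext v
  rw [tup_set hn s σ, tup_set hn s' σ', h]

open Classical in
/-- the set of a good tuple -/
noncomputable def phi (hn : n ≤ N) (t : Fin k → Fin N) : Option {s : Finset (Fin n) // s.card = k} :=
  if h : ∃ s, ∃ σ : Fin k ≃ s.1, t = tup hn s σ then some h.choose else none

lemma phi_iff (hn : n ≤ N) (t : Fin k → Fin N) (s : {s : Finset (Fin n) // s.card = k}) :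
    phi hn t = some s ↔ ∃ σ : Fin k ≃ s.1, t = tup hn s σ := by
  unfold phi
  constructor
  · intro h
    split_ifs at h with h'
    have := h'.choose_spec
    simp only [Option.some.injEq] at h
    rw [h] at this
    exact this
  · rintro ⟨σ, hσ⟩
    have h' : ∃ s, ∃ σ : Fin k ≃ s.1, t = tup hn s σ := ⟨s, σ, hσ⟩
    rw [dif_pos h']
    obtain ⟨σ', hσ'⟩ := h'.choose_spec
    congr 1
    exact tup_inj hn _ _ σ' σ (hσ'.symm.trans hσ)

open Classical in
lemma phi_fiber (hn : n ≤ N) (s : {s : Finset (Fin n) // s.card = k}) :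
    (Finset.univ.filter fun t : Fin k → Fin N => phi hn t = some s).card = k.factorial := by
  have h1 : (Finset.univ.filter fun t : Fin k → Fin N => phi hn t = some s) =
      Finset.univ.image (fun σ : Fin k ≃ s.1 => tup hn s σ) := by
    ext t
    simp [phi_iff, eq_comm]
  rw [h1, Finset.card_image_of_injective]
  · have e : Fin k ≃ s.1 := (Fintype.equivFinOfCardEq (by simp [s.2])).symm
    rw [Finset.card_univ, Fintype.card_equiv e, Fintype.card_fin]
  · intro σ σ' h
    ext i
    have := congrFun h i
    have := Fin.castLE_injective hn this
    rw [this]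

open Classical in
lemma prob_eq (k n m : ℕ) : probTwoColorable k n m =
    𝔼 E : Fin m → {s : Finset (Fin n) // s.card = k}, (if IsTwoColorable E then (1:ℝ) else 0) := by
  unfold probTwoColorable
  rw [Fintype.expect_eq_sum_div_card, Nat.card_eq_fintype_card, Fintype.card_subtype]
  congr 1
  · simp
  · have := Fintype.card_finset_len (α := Fin n) k
    simp at this
    simp

lemma good_frac (hkn : k ≤ n) (hn : n ≤ N) (hN : N ≤ n + 3) (hk : 0 < k) :
    1 - (k:ℝ) * (k + 3) / N ≤ (k.factorial : ℝ) * (n.choose k) / (N:ℝ) ^ k := by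
  have hNp : (0:ℝ) < N := by
    have : 0 < N := by omega
    exact_mod_cast this
  have h1 : ((n + 1 - k : ℕ) : ℝ) ^ k ≤ (k.factorial : ℝ) * (n.choose k) := by
    have := Nat.pow_sub_le_descFactorial n k
    rw [Nat.descFactorial_eq_factorial_mul_choose] at this
    exact_mod_cast this
  have h2 : (N:ℝ) - (k + 3) ≤ ((n + 1 - k : ℕ) : ℝ) := by
    rw [Nat.cast_sub (by omega)]
    have : (N:ℝ) ≤ n + 3 := by exact_mod_cast hN
    push_cast; linarith
  rw [le_div_iff₀ (by positivity)]
  refine le_trans ?_ h1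
  rcases le_or_gt ((k:ℝ) + 3) N with h | h
  · refine le_trans ?_ (pow_le_pow_left₀ (by linarith) h2 k)
    have h3 := one_add_mul_le_pow (a := -(((k:ℝ) + 3) / N)) (by
      have : ((k:ℝ) + 3) / N ≤ 1 := by rw [div_le_one hNp]; exact h
      linarith) k
    have e : (N:ℝ) - (k + 3) = (1 + -(((k:ℝ) + 3) / N)) * N := by field_simp; ring
    rw [e, mul_pow]
    refine mul_le_mul_of_nonneg_right (le_trans (le_of_eq ?_) h3) (by positivity)
    ring
  · have : (1:ℝ) ≤ k * (k + 3) / N := by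
      rw [le_div_iff₀ hNp]
      have : (1:ℝ) ≤ k := by exact_mod_cast hk
      nlinarith
    have h4 : (0:ℝ) ≤ (N:ℝ) ^ k := by positivity
    have h5 : (0:ℝ) ≤ ((n + 1 - k : ℕ) : ℝ) ^ k := by positivity
    nlinarith

open Classical in
lemma bad_frac (hkn : k ≤ n) (hn : n ≤ N) (hN : N ≤ n + 3) (hk : 0 < k) :
    𝔼 t : Fin k → Fin N, (if phi hn t = none then (1:ℝ) else 0) ≤ (k:ℝ) * (k + 3) / N := by
  have hNp : 0 < N := by omega
  have : Nonempty (Fin N) := ⟨⟨0, hNp⟩⟩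
  have h0 := good_frac hkn hn hN hk
  have h1 : ∑ t : Fin k → Fin N, (if phi hn t = none then (1:ℝ) else 0) + (k.factorial : ℝ) * (n.choose k) = (N:ℝ) ^ k := by
    have h2 : ∑ t : Fin k → Fin N, (1:ℝ) = (N:ℝ) ^ k := by simp
    rw [← Finset.sum_fiberwise (s := Finset.univ) (g := phi hn), Fintype.sum_option] at h2
    rw [← h2]
    congr 1
    · simp
    · simp only [Finset.sum_const, phi_fiber, nsmul_eq_mul, mul_one]
      have := Fintype.card_finset_len (α := Fin n) k
      simp at this
      simp [mul_comm]
  rw [Fintype.expect_eq_sum_div_card]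
  have hc : ((Fintype.card (Fin k → Fin N) : ℕ) : ℝ) = (N:ℝ) ^ k := by simp
  have hp : (0:ℝ) < (N:ℝ) ^ k := by
    have : (0:ℝ) < N := by exact_mod_cast hNp
    positivity
  rw [hc, eq_sub_of_add_eq h1, sub_div, div_self hp.ne']
  linarith

lemma expect_coord {T : Type*} [Fintype T] [Nonempty T] (f : T → ℝ) (m : ℕ) (i : Fin m) :
    𝔼 e : Fin m → T, f (e i) = 𝔼 t, f t := by
  induction m with
  | zero => exact i.elim0
  | succ m ih =>
    rw [expect_fin_succ']
    refine Fin.cases ?_ (fun j => ?_) i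
    · simp [Fin.cons_zero]
    · simp only [Fin.cons_succ, ih j]
      simp

set_option maxHeartbeats 2000000 in
open Classical in
theorem reduction (hkn : k ≤ n) (hn : n ≤ N) (hN : N ≤ n + 3) (hk : 0 < k) (m m' : ℕ) (hm : m ≤ m') :
    1 - 𝔼 e : Fin m' → Fin k → Fin N, (if TC e then (0:ℝ) else 1) -
      (m':ℝ) * (k * (k + 3) / N) / ((m':ℝ) - m + 1) ≤ probTwoColorable k n m := by
  have hNp : 0 < N := by omega
  have : Nonempty (Fin N) := ⟨⟨0, hNp⟩⟩
  have : Nonempty {s : Finset (Fin n) // s.card = k} := by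
    obtain ⟨S, -, hS⟩ := Finset.exists_subset_card_eq
      (show k ≤ (Finset.univ : Finset (Fin n)).card by simpa using hkn)
    exact ⟨⟨S, hS⟩⟩
  have hc := couple (phi (k := k) hn) (fun s => {c : Fin n → Bool | ∃ u ∈ s.1, ∃ v ∈ s.1, c u ≠ c v})
    k.factorial (fun s => by convert phi_fiber (k := k) hn s) m' m Set.univ
  have hd : (0:ℝ) < (m':ℝ) - m + 1 := by
    have : (m:ℝ) ≤ m' := by exact_mod_cast hm
    linarith
  have key : ∀ (p : Prop) (d : Decidable p), (0:ℝ) ≤ @ite ℝ p d 1 0 := by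
    intro p d; split_ifs <;> norm_num
  have main : 𝔼 e : Fin m' → Fin k → Fin N, (1 - (if TC e then (0:ℝ) else 1) -
      (∑ i, (if phi hn (e i) = none then (1:ℝ) else 0)) / ((m':ℝ) - m + 1)) ≤ probTwoColorable k n m := by
    refine le_trans (le_trans (Finset.expect_le_expect fun e _ => ?_) hc) (le_of_eq ?_)
    swap
    · rw [prob_eq]
      refine Finset.expect_congr rfl fun E _ => ?_
      refine @if_congr _ _ _ (_) (_) _ _ _ _ ?_ rfl rfl
      simp [IsTwoColorable]
    have hs0 : 0 ≤ (∑ i, (if phi hn (e i) = none then (1:ℝ) else 0)) / ((m':ℝ) - m + 1) :=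
      div_nonneg (Finset.sum_nonneg fun i _ => key _ _) hd.le
    by_cases h1 : TC e
    · by_cases h2 : m ≤ (Finset.univ.filter fun i => phi hn (e i) ≠ none).card
      · have hex : ∃ c ∈ (Set.univ : Set (Fin n → Bool)), ∀ i s, phi hn (e i) = some s →
            c ∈ {c : Fin n → Bool | ∃ u ∈ s.1, ∃ v ∈ s.1, c u ≠ c v} := by
          obtain ⟨c, hc⟩ := h1
          refine ⟨fun v => c (Fin.castLE hn v), Set.mem_univ _, fun i s hs => ?_⟩
          obtain ⟨σ, hσ⟩ := (phi_iff hn _ s).1 hs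
          obtain ⟨u, v, huv⟩ := hc i
          rw [hσ] at huv
          exact ⟨(σ u).1, (σ u).2, (σ v).1, (σ v).2, huv⟩
        rw [if_pos h1, if_pos ⟨hex, h2⟩]
        linarith
      · have hsum : (∑ i, (if phi hn (e i) = none then (1:ℝ) else 0)) =
            m' - (Finset.univ.filter fun i => phi hn (e i) ≠ none).card := by
          have := Finset.card_filter_add_card_filter_not (s := (Finset.univ : Finset (Fin m'))) (fun i => phi hn (e i) = none)
          rw [Finset.sum_boole, eq_sub_iff_add_eq]
          simp only [Finset.card_univ, Fintype.card_fin] at this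
          exact_mod_cast this
        have h3 : (1:ℝ) ≤ (∑ i, (if phi hn (e i) = none then (1:ℝ) else 0)) / ((m':ℝ) - m + 1) := by
          rw [le_div_iff₀ hd, hsum]
          have : (((Finset.univ.filter fun i => phi hn (e i) ≠ none).card + 1 : ℕ) : ℝ) ≤ m := by
            exact_mod_cast (not_le.1 h2)
          push_cast at this
          linarith
        rw [if_pos h1]
        refine le_trans ?_ (key _ _)
        linarith
    · rw [if_neg h1]
      refine le_trans ?_ (key _ _)
      linarith
  refine le_trans ?_ main
  rw [Finset.expect_sub_distrib, Finset.expect_sub_distrib, Finset.expect_const Finset.univ_nonempty,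
    ← Finset.expect_div, Finset.expect_sum_comm]
  refine sub_le_sub_left (div_le_div_of_nonneg_right ?_ hd.le) _
  have hb := bad_frac hkn hn hN hk
  calc _ = ∑ i : Fin m', 𝔼 t : Fin k → Fin N, (if phi hn t = none then (1:ℝ) else 0) :=
        Finset.sum_congr rfl fun i _ => expect_coord (fun t => if phi hn t = none then (1:ℝ) else 0) m' i
    _ ≤ ∑ i : Fin m', (k:ℝ) * (k + 3) / N := Finset.sum_le_sum fun i _ => hb
    _ = _ := by simp

end Reduction
end HG

namespace HG

lemma prob_le_one {k n : ℕ} (hkn : k ≤ n) (m : ℕ) : probTwoColorable k n m ≤ 1 := by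
  have : Nonempty {s : Finset (Fin n) // s.card = k} := by
    obtain ⟨S, -, hS⟩ := Finset.exists_subset_card_eq
      (show k ≤ (Finset.univ : Finset (Fin n)).card by simpa using hkn)
    exact ⟨⟨S, hS⟩⟩
  rw [prob_eq]
  exact Finset.expect_le Finset.univ_nonempty fun E _ => by split_ifs <;> norm_num

lemma Good.final {ε y R : ℝ} {k : ℕ} (g : Good ε k y R) (r : ℝ) (hr : 0 < r) (hrR : r ≤ R - ε / 2) :
    Tendsto (fun n : ℕ => probTwoColorable k n ⌈r * n⌉₊) atTop (nhds 1) := by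
  have he := g.he
  have hR := g.r_pos
  have hk : 0 < k := by have := g.hk; omega
  rw [Metric.tendsto_nhds]
  intro δ hδ
  have ht : Tendsto (fun n : ℕ => (n + 3) / 4) atTop atTop := by
    refine tendsto_atTop.2 fun b => ?_
    filter_upwards [eventually_ge_atTop (4 * b)] with n hn
    omega
  have hev := ht.eventually (g.tuple_bound (δ / 3) (by positivity))
  set C : ℝ := R * (k * (k + 3)) with hC
  have hCp : 0 ≤ C := by positivity
  filter_upwards [hev, eventually_ge_atTop k, eventually_ge_atTop ⌈(2 + 3 * C / δ) / (ε / 2)⌉₊] with n hb hkn hn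
  set L := (n + 3) / 4 with hL
  have hn1 : n ≤ 4 * L := by omega
  have hn2 : 4 * L ≤ n + 3 := by omega
  have hNp : (0:ℝ) < ((4 * L : ℕ) : ℝ) := by
    have : 0 < 4 * L := by omega
    exact_mod_cast this
  have hnN : (n:ℝ) ≤ ((4 * L : ℕ) : ℝ) := by exact_mod_cast hn1
  set m' := ⌊R * ((4 * L : ℕ) : ℝ)⌋₊ with hm'
  have hm'1 : (m':ℝ) ≤ R * ((4 * L : ℕ) : ℝ) := Nat.floor_le (by positivity)
  have hm'2 : R * ((4 * L : ℕ) : ℝ) < m' + 1 := Nat.lt_floor_add_one _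
  have hm1 : ((⌈r * n⌉₊ : ℕ) : ℝ) < r * n + 1 := Nat.ceil_lt_add_one (by positivity)
  have hn3 : 2 + 3 * C / δ ≤ ε / 2 * n := by
    have := Nat.ceil_le.1 hn
    rw [div_le_iff₀ (by positivity)] at this
    linarith
  have hC3 : 0 ≤ 3 * C / δ := by positivity
  have h1 : ε / 2 * n ≤ (R - r) * ((4 * L : ℕ) : ℝ) :=
    mul_le_mul (by linarith) hnN (by positivity) (by linarith)
  have h2 : r * n ≤ r * ((4 * L : ℕ) : ℝ) := by gcongr
  have h3 : 3 * C / δ < (m':ℝ) - ⌈r * n⌉₊ + 1 := by nlinarith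
  have h4 : ⌈r * n⌉₊ ≤ m' := by
    have : ((⌈r * n⌉₊ : ℕ) : ℝ) < m' + 1 := by linarith
    have : ⌈r * n⌉₊ < m' + 1 := by exact_mod_cast this
    omega
  have hred := reduction hkn hn1 hn2 hk ⌈r * n⌉₊ m' h4
  have hb' := hb m' (by push_cast at hm'1; exact hm'1)
  have h5 : (m':ℝ) * (k * (k + 3) / ((4 * L : ℕ) : ℝ)) / ((m':ℝ) - ⌈r * n⌉₊ + 1) ≤ δ / 3 := by
    have hd : (0:ℝ) < (m':ℝ) - ⌈r * n⌉₊ + 1 := by linarith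
    rw [div_le_iff₀ hd]
    calc (m':ℝ) * (k * (k + 3) / ((4 * L : ℕ) : ℝ)) ≤ (R * ((4 * L : ℕ) : ℝ)) * (k * (k + 3) / ((4 * L : ℕ) : ℝ)) := by
          gcongr
      _ = C := by rw [hC]; field_simp
      _ = δ / 3 * (3 * C / δ) := by field_simp
      _ ≤ _ := by gcongr
  have h6 := prob_le_one hkn ⌈r * n⌉₊
  rw [Real.dist_eq, abs_lt]
  constructor <;> linarith

end HG

/-- For every ε > 0 there exists k₀ = k₀(ε) such that for all integers k ≥ k₀ and every
real r with 0 < r ≤ 2^{k-1} ln 2 − (ln 2)/2 − (1+ε)/2, the probability that the random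
hypergraph H_k(n, ⌈rn⌉) is 2-colorable tends to 1 as n → ∞. -/
theorem hypergraph_two_colorable_lower_bound :
    ∀ ε : ℝ, 0 < ε → ∃ k₀ : ℕ, ∀ k : ℕ, k₀ ≤ k → ∀ r : ℝ, 0 < r →
      r ≤ (2 : ℝ) ^ (k - 1) * Real.log 2 - Real.log 2 / 2 - (1 + ε) / 2 →
      Tendsto (fun n : ℕ => probTwoColorable k n ⌈r * n⌉₊) atTop (nhds 1) := by
  intro ε hε
  have h1 : 0 < min ε 1 := lt_min hε one_pos
  obtain ⟨k₀, hk₀⟩ := HG.good_exists (min ε 1 / 2) (by linarith) (by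
    have := min_le_right ε 1
    linarith)
  refine ⟨k₀, fun k hk r hr hle => (hk₀ k hk).final r hr ?_⟩
  have := min_le_left ε 1
  linarith
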